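/- arXiv:2512.10039 — 4 statements merged into one kernel-verified Lean document; each statement's English description precedes it below -/
import Mathlib

section
/- Under the fulcrum hypotheses, the k-linear map T(V) ⊗_k H → T(V)#_M H sending a ⊗ h to π(ι(f(h))) · π(T(s)(a)) is bijective, where T(s) : T(V) → T(M) is the algebra homomorphism induced by the linear map s. Equivalently, the linear endomorphism of T(V)#_M H sending π(T(s)(a))π(ι(f(h))) to π(ι(f(h)))π(T(s)(a)) (for a ∈ T(V), h ∈ H) is a well-defined bijection. -/
open TensorProduct

/-- For a left module `M` over a `k`-algebra `H`, the `k`-linear map `h ↦ h • x`. -/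
noncomputable def actL (k : Type*) {H M : Type*} [CommSemiring k] [Semiring H] [Algebra k H]
    [AddCommMonoid M] [Module k M] [Module H M] [IsScalarTower k H M] (x : M) :
    H →ₗ[k] M where
  toFun h := h • x
  map_add' a b := add_smul a b x
  map_smul' c a := smul_assoc c a x

/-- The adjoint action `h ↦ Σ h₁ a S(h₂)` of a Hopf algebra on itself,
as a `k`-linear map in `h`. -/
noncomputable def adjL (k : Type*) {H : Type*} [CommSemiring k] [Semiring H] [HopfAlgebra k H]
    (a : H) : H →ₗ[k] H :=
  LinearMap.mul' k H ∘ₗ TensorProduct.map (LinearMap.mulRight k a)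
    (HopfAlgebra.antipode (R := k)) ∘ₗ Coalgebra.comul

/-- `Σ ι(h₁ • x) · ι(f h₂)`, as a `k`-linear map in `h`, inside the tensor algebra `T(M)`. -/
noncomputable def commRHS (k : Type*) {H M : Type*} [CommSemiring k] [Semiring H]
    [HopfAlgebra k H] [AddCommMonoid M] [Module k M] [Module H M] [IsScalarTower k H M]
    (f : H →ₗ[k] M) (x : M) : H →ₗ[k] TensorAlgebra k M :=
  LinearMap.mul' k (TensorAlgebra k M) ∘ₗ
    TensorProduct.map ((TensorAlgebra.ι k (M := M)) ∘ₗ actL k x)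
      ((TensorAlgebra.ι k (M := M)) ∘ₗ f) ∘ₗ
    Coalgebra.comul

/-- The defining relations of the fulcrum `T(V)#_M H`:
`ι(f h)ι(f h') = ι(f (h h'))`, `ι(f 1) = 1`, and `ι(f h)ι(x) = Σ ι(h₁ • x)ι(f h₂)`. -/
def fulcrumRel (k : Type*) {H M : Type*} [CommSemiring k] [Semiring H] [HopfAlgebra k H]
    [AddCommMonoid M] [Module k M] [Module H M] [IsScalarTower k H M] (f : H →ₗ[k] M)
    (u v : TensorAlgebra k M) : Prop :=
  (∃ h h' : H, u = TensorAlgebra.ι k (f h) * TensorAlgebra.ι k (f h') ∧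
      v = TensorAlgebra.ι k (f (h * h'))) ∨
  (u = TensorAlgebra.ι k (f 1) ∧ v = 1) ∨
  (∃ (h : H) (x : M), u = TensorAlgebra.ι k (f h) * TensorAlgebra.ι k x ∧
      v = commRHS k f x h)


open Coalgebra HopfAlgebra

namespace FulcrumAux

section sweedler

variable {k H N : Type*} [Field k] [Ring H] [HopfAlgebra k H] [AddCommGroup N] [Module k N]

theorem repr_lift {ι : Type*} {h : H} (r : Coalgebra.Repr k h ι) (β : H →ₗ[k] H →ₗ[k] N) :
    TensorProduct.lift β (comul h) = ∑ i ∈ r.index, β (r.left i) (r.right i) := by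
  rw [← r.eq]; simp

theorem tri_coassoc (h : H) (t : H →ₗ[k] H →ₗ[k] H →ₗ[k] N) :
    ∑ i ∈ (ℛ k h).index, ∑ j ∈ (ℛ k ((ℛ k h).left i)).index,
      t ((ℛ k ((ℛ k h).left i)).left j) ((ℛ k ((ℛ k h).left i)).right j) ((ℛ k h).right i) =
    ∑ i ∈ (ℛ k h).index, ∑ j ∈ (ℛ k ((ℛ k h).right i)).index,
      t ((ℛ k h).left i) ((ℛ k ((ℛ k h).right i)).left j)
        ((ℛ k ((ℛ k h).right i)).right j) := by
  have := congrArg (TensorProduct.lift ((TensorProduct.uncurry (.id k) H H N) ∘ₗ t))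
    (sum_tmul_tmul_eq (ℛ k h) (fun i => ℛ k ((ℛ k h).left i)) (fun i => ℛ k ((ℛ k h).right i)))
  simpa [map_sum] using this

theorem collapse_left (h : H) (B : H →ₗ[k] H →ₗ[k] N) (μ : H →ₗ[k] H →ₗ[k] H)
    (hμ : ∀ g : H, ∑ i ∈ (ℛ k g).index, μ ((ℛ k g).left i) ((ℛ k g).right i) =
      counit (R := k) g • (1 : H)) :
    ∑ i ∈ (ℛ k h).index, ∑ j ∈ (ℛ k ((ℛ k h).right i)).index,
      B (μ ((ℛ k h).left i) ((ℛ k ((ℛ k h).right i)).left j))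
        ((ℛ k ((ℛ k h).right i)).right j) = B 1 h := by
  have := tri_coassoc h (μ.compr₂ B)
  simp only [LinearMap.compr₂_apply] at this
  rw [← this]
  simp only [← LinearMap.sum_apply, ← map_sum, hμ]
  simp only [map_smul, LinearMap.smul_apply]
  simp only [← map_smul, ← map_sum, sum_counit_smul]

theorem sum_smul_counit (h : H) :
    ∑ i ∈ (ℛ k h).index, counit (R := k) ((ℛ k h).right i) • (ℛ k h).left i = h := by
  have := congrArg (TensorProduct.rid k H) (sum_tmul_counit_eq (ℛ k h))
  rw [map_sum] at this
  simpa only [TensorProduct.rid_tmul, one_smul] using this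

theorem collapse_right (h : H) (B : H →ₗ[k] H →ₗ[k] N) (μ : H →ₗ[k] H →ₗ[k] H)
    (hμ : ∀ g : H, ∑ i ∈ (ℛ k g).index, μ ((ℛ k g).left i) ((ℛ k g).right i) =
      counit (R := k) g • (1 : H)) :
    ∑ i ∈ (ℛ k h).index, ∑ j ∈ (ℛ k ((ℛ k h).left i)).index,
      B ((ℛ k ((ℛ k h).left i)).left j)
        (μ ((ℛ k ((ℛ k h).left i)).right j) ((ℛ k h).right i)) = B h 1 := by
  have := tri_coassoc h ((LinearMap.lcomp k (H →ₗ[k] N) μ) ∘ₗ (LinearMap.llcomp k H H N) ∘ₗ B)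
  simp only [LinearMap.comp_apply, LinearMap.lcomp_apply, LinearMap.llcomp_apply] at this
  rw [this]
  simp only [← map_sum, hμ]
  conv_rhs => rw [← sum_smul_counit (k := k) h]
  simp only [map_sum, map_smul, LinearMap.sum_apply, LinearMap.smul_apply]

/-- inverse of the antipode -/
noncomputable def sinv (hS : Function.Bijective (antipode k (A := H))) : H →ₗ[k] H :=
  (LinearEquiv.ofBijective (antipode k (A := H)) hS).symm.toLinearMap

variable (hS : Function.Bijective (antipode k (A := H)))

theorem S_sinv (h : H) : antipode k (sinv hS h) = h :=
  (LinearEquiv.ofBijective (antipode k (A := H)) hS).apply_symm_apply h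

theorem sinv_mul (a b : H) : sinv hS (a * b) = sinv hS b * sinv hS a := by
  apply hS.1
  rw [antipode_mul_antidistrib]; simp only [S_sinv]

theorem sinv_one : sinv hS (1 : H) = 1 := by
  apply hS.1
  rw [S_sinv, antipode_one]

/-- `q, p ↦ S⁻¹ q * p` -/
noncomputable def mu1 : H →ₗ[k] H →ₗ[k] H := (LinearMap.mul k H).flip.compl₂ (sinv hS)
/-- `q, p ↦ q * S⁻¹ p` -/
noncomputable def mu2 : H →ₗ[k] H →ₗ[k] H := (LinearMap.mul k H).flip ∘ₗ (sinv hS)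

theorem mu1_apply (p q : H) : mu1 hS p q = sinv hS q * p := rfl
theorem mu2_apply (p q : H) : mu2 hS p q = q * sinv hS p := rfl

theorem mu1_spec (g : H) : ∑ i ∈ (ℛ k g).index, mu1 hS ((ℛ k g).left i) ((ℛ k g).right i) =
      counit (R := k) g • (1 : H) := by
  apply hS.1
  simp only [map_sum, mu1_apply, antipode_mul_antidistrib, S_sinv, map_smul, antipode_one]
  exact sum_antipode_mul_eq_smul _

theorem mu2_spec (g : H) : ∑ i ∈ (ℛ k g).index, mu2 hS ((ℛ k g).left i) ((ℛ k g).right i) =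
      counit (R := k) g • (1 : H) := by
  apply hS.1
  simp only [map_sum, mu2_apply, antipode_mul_antidistrib, S_sinv, map_smul, antipode_one]
  exact sum_mul_antipode_eq_smul _

theorem adjL_repr {ι : Type*} (a : H) {h : H} (r : Coalgebra.Repr k h ι) :
    adjL k a h = ∑ i ∈ r.index, r.left i * a * antipode k (r.right i) := by
  simp [adjL, ← r.eq, map_sum]

theorem adjL_one (a : H) : adjL k a 1 = a := by
  simp [adjL, Algebra.TensorProduct.one_def]

theorem adjL_mul (a h : H) :
    ∑ i ∈ (ℛ k h).index, adjL k a ((ℛ k h).left i) * (ℛ k h).right i = h * a := by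
  have := collapse_right h ((LinearMap.mul k H) ∘ₗ (LinearMap.mulRight k a))
    ((LinearMap.mul k H) ∘ₗ antipode k) (fun g => by
      simpa using sum_antipode_mul_eq_smul (ℛ k g))
  simp only [LinearMap.comp_apply, LinearMap.mul_apply', LinearMap.mulRight_apply, mul_one] at this
  rw [← this]
  refine Finset.sum_congr rfl fun i _ => ?_
  rw [adjL_repr a (ℛ k _), Finset.sum_mul]
  simp only [mul_assoc]

end sweedler

section main

variable {k H M V : Type*} [Field k] [Ring H] [HopfAlgebra k H]
    [AddCommGroup M] [Module k M] [Module H M] [IsScalarTower k H M]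
    [AddCommGroup V] [Module k V]

variable (hS : Function.Bijective (antipode k (A := H)))

theorem exists_proj (f : H →ₗ[k] M) (s : V →ₗ[k] M)
    (hf : Function.Injective f) (hs : Function.Injective s)
    (hcompl : IsCompl (LinearMap.range f) (LinearMap.range s)) :
    ∃ (pH : M →ₗ[k] H) (pV : M →ₗ[k] V), (∀ h, pH (f h) = h) ∧ (∀ h, pV (f h) = 0) ∧
      (∀ v, pH (s v) = 0) ∧ (∀ v, pV (s v) = v) ∧ ∀ x, f (pH x) + s (pV x) = x := by
  have hb : Function.Bijective (f.coprod s) := by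
    constructor
    · rw [← LinearMap.ker_eq_bot, LinearMap.ker_coprod_of_disjoint_range _ _ hcompl.disjoint,
        LinearMap.ker_eq_bot.2 hf, LinearMap.ker_eq_bot.2 hs, Submodule.prod_bot]
    · rw [← LinearMap.range_eq_top, LinearMap.range_coprod, hcompl.sup_eq_top]
  let e := LinearEquiv.ofBijective (f.coprod s) hb
  have h1 : ∀ h, e.symm (f h) = (h, 0) := fun h => by
    rw [LinearEquiv.symm_apply_eq]; simp [e]
  have h2 : ∀ v, e.symm (s v) = (0, v) := fun h => by
    rw [LinearEquiv.symm_apply_eq]; simp [e]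
  refine ⟨LinearMap.fst k H V ∘ₗ e.symm.toLinearMap, LinearMap.snd k H V ∘ₗ e.symm.toLinearMap,
    ?_, ?_, ?_, ?_, ?_⟩
  · intro h; simp [h1]
  · intro h; simp [h1]
  · intro h; simp [h2]
  · intro h; simp [h2]
  · intro x
    have := e.apply_symm_apply x
    rwa [LinearEquiv.ofBijective_apply, LinearMap.coprod_apply] at this

/-- `F y t = p_H(y) ⊗ t + 1 ⊗ p_V(y) t`. -/
noncomputable def Fmap (pH : M →ₗ[k] H) (pV : M →ₗ[k] V) :
    M →ₗ[k] TensorAlgebra k V →ₗ[k] (H ⊗[k] TensorAlgebra k V) :=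
  TensorProduct.mk k H (TensorAlgebra k V) ∘ₗ pH +
    (LinearMap.llcomp k _ _ _ (TensorProduct.mk k H (TensorAlgebra k V) 1)) ∘ₗ
      (LinearMap.mul k (TensorAlgebra k V)) ∘ₗ (TensorAlgebra.ι k) ∘ₗ pV

theorem Fmap_apply (pH : M →ₗ[k] H) (pV : M →ₗ[k] V) (y : M) (t : TensorAlgebra k V) :
    Fmap pH pV y t = pH y ⊗ₜ t + 1 ⊗ₜ (TensorAlgebra.ι k (pV y) * t) := rfl

variable {T E : Type*} [AddCommGroup T] [Module k T] [AddCommGroup E] [Module k E] [Module H E]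
  [IsScalarTower k H E]

/-- `x, h₁, h₂ ↦ (t ↦ h₂ • F (S⁻¹ h₁ • x) t)`. -/
noncomputable def Kmap (F : M →ₗ[k] T →ₗ[k] E) :
    M →ₗ[k] H →ₗ[k] H →ₗ[k] T →ₗ[k] E where
  toFun x := (LinearMap.llcomp k T E E).flip.compl₂ (Algebra.lsmul k k E).toLinearMap ∘ₗ
    F ∘ₗ actL k x ∘ₗ sinv hS
  map_add' x y := by
    ext a b t; simp [actL]
  map_smul' c x := by
    ext a b t
    simp [actL, smul_algebra_smul_comm]

theorem Kmap_apply (F : M →ₗ[k] T →ₗ[k] E) (x : M) (a b : H) (t : T) :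
    Kmap hS F x a b t = b • F (sinv hS a • x) t := rfl

/-- The action of `M`. -/
noncomputable def theta (F : M →ₗ[k] T →ₗ[k] (H ⊗[k] T)) :
    M →ₗ[k] Module.End k (H ⊗[k] T) :=
  (TensorProduct.uncurry (.id k) H T (H ⊗[k] T)) ∘ₗ
    (LinearMap.lcomp k (T →ₗ[k] H ⊗[k] T) (comul (R := k) (A := H))) ∘ₗ
    (TensorProduct.uncurry (.id k) H H (T →ₗ[k] H ⊗[k] T)) ∘ₗ Kmap hS F

theorem theta_tmul (F : M →ₗ[k] T →ₗ[k] (H ⊗[k] T)) (x : M) (h : H) (t : T) :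
    theta hS F x (h ⊗ₜ t) = TensorProduct.lift (Kmap hS F x) (comul h) t := rfl

theorem theta_repr {ι : Type*} (F : M →ₗ[k] T →ₗ[k] (H ⊗[k] T)) (x : M) {h : H} (t : T)
    (r : Coalgebra.Repr k h ι) :
    theta hS F x (h ⊗ₜ t) = ∑ i ∈ r.index, r.right i • F (sinv hS (r.left i) • x) t := by
  rw [theta_tmul, ← r.eq, map_sum, LinearMap.sum_apply]
  rfl

theorem theta_one (F : M →ₗ[k] T →ₗ[k] (H ⊗[k] T)) (x : M) (t : T) :
    theta hS F x (1 ⊗ₜ t) = F x t := by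
  rw [theta_tmul, Bialgebra.comul_one, Algebra.TensorProduct.one_def, TensorProduct.lift.tmul,
    Kmap_apply, sinv_one, one_smul, one_smul]

theorem theta_rel (F : M →ₗ[k] T →ₗ[k] (H ⊗[k] T)) (x : M) (a h : H) (t : T) :
    ∑ i ∈ (ℛ k a).index, theta hS F ((ℛ k a).left i • x) (((ℛ k a).right i * h) ⊗ₜ t) =
      a • theta hS F x (h ⊗ₜ t) := by
  have key : ∀ p : H, ∀ q : H, _ := fun p q => collapse_left a
    (LinearMap.flip ((LinearMap.llcomp k H _ _).flip
      ((F.flip t) ∘ₗ actL k x ∘ₗ (LinearMap.mulLeft k (sinv hS p))) ∘ₗ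
      (Algebra.lsmul k k (H ⊗[k] T)).toLinearMap ∘ₗ LinearMap.mulRight k q))
    (mu1 hS) (mu1_spec hS)
  rw [theta_repr hS F x t (ℛ k h), Finset.smul_sum]
  have h1 : ∀ i, theta hS F ((ℛ k a).left i • x) (((ℛ k a).right i * h) ⊗ₜ t) = 
      ∑ j ∈ (ℛ k ((ℛ k a).right i)).index, ∑ l ∈ (ℛ k h).index, 
        ((ℛ k ((ℛ k a).right i)).right j * (ℛ k h).right l) • 
          F ((sinv hS ((ℛ k h).left l) * 
            (sinv hS ((ℛ k ((ℛ k a).right i)).left j) * (ℛ k a).left i)) • x) t := by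
    intro i
    rw [theta_repr hS F _ t ((ℛ k ((ℛ k a).right i)).mul (ℛ k h))]
    simp [Coalgebra.Repr.mul, Finset.sum_product, sinv_mul, mul_smul]
  simp only [h1]
  rw [Finset.sum_congr rfl fun i _ => Finset.sum_comm (s := (ℛ k ((ℛ k a).right i)).index)
    (t := (ℛ k h).index), Finset.sum_comm]
  refine Finset.sum_congr rfl fun l _ => ?_
  have := key ((ℛ k h).left l) ((ℛ k h).right l)
  simp [mu1_apply, actL] at this
  simp only [mul_smul] at this ⊢
  exact this

theorem theta_f (f : H →ₗ[k] M) (hf : Function.Injective f)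
    (hadj : ∀ h a : H, h • f a = f (adjL k a h))
    (F : M →ₗ[k] T →ₗ[k] (H ⊗[k] T)) (hF : ∀ h t, F (f h) t = h ⊗ₜ t) (a h : H) (t : T) :
    theta hS F (f a) (h ⊗ₜ t) = (a * h) ⊗ₜ t := by
  rw [theta_repr hS F _ t (ℛ k h)]
  simp only [hadj, hF, TensorProduct.smul_tmul', smul_eq_mul, ← TensorProduct.sum_tmul]
  congr 1
  have := collapse_left h ((LinearMap.mul k H) ∘ₗ (adjL k a)) (mu2 hS) (mu2_spec hS)
  simp only [LinearMap.comp_apply, LinearMap.mul_apply', adjL_one, mu2_apply] at this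
  rw [← this]
  refine Finset.sum_congr rfl fun i _ => ?_
  rw [← adjL_mul (k := k)]
  refine Finset.sum_congr rfl fun j _ => ?_
  congr 1
  apply hf
  rw [← hadj, ← hadj, ← hadj, mul_smul]

theorem commRHS_repr {ι : Type*} (f : H →ₗ[k] M) (x : M) {h : H} (r : Coalgebra.Repr k h ι) :
    commRHS k f x h = ∑ i ∈ r.index, TensorAlgebra.ι k (r.left i • x) *
      TensorAlgebra.ι k (f (r.right i)) := by
  simp [commRHS, ← r.eq, map_sum, actL]

end main

end FulcrumAux

open FulcrumAux



/-- Under the fulcrum hypotheses, the `k`-linear map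
`T(V) ⊗ₖ H → T(V)#_M H`, `a ⊗ h ↦ π(ι(f(h))) · π(T(s)(a))`, is bijective. -/
theorem fulcrum_tensor_decomposition'
    {k H M V : Type*} [Field k] [Ring H] [HopfAlgebra k H]
    [AddCommGroup M] [Module k M] [Module H M] [IsScalarTower k H M]
    [AddCommGroup V] [Module k V]
    (f : H →ₗ[k] M) (s : V →ₗ[k] M)
    (hf : Function.Injective f) (hs : Function.Injective s)
    (hS : Function.Bijective (HopfAlgebra.antipode (R := k) (A := H)))
    (hadj : ∀ h a : H, h • f a = f (adjL k a h))
    (hcompl : IsCompl (LinearMap.range f) (LinearMap.range s)) :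
    Function.Bijective (LinearMap.mul' k (RingQuot (fulcrumRel k f)) ∘ₗ
      TensorProduct.map
        ((RingQuot.mkAlgHom k (fulcrumRel k f)).toLinearMap ∘ₗ
          (TensorAlgebra.ι k (M := M)) ∘ₗ f)
        ((RingQuot.mkAlgHom k (fulcrumRel k f)).toLinearMap ∘ₗ
          (TensorAlgebra.lift k ((TensorAlgebra.ι k (M := M)) ∘ₗ s)).toLinearMap) ∘ₗ
      (TensorProduct.comm k (TensorAlgebra k V) H).toLinearMap) := by
  classical
  obtain ⟨pH, pV, h1, h2, h3, h4, h5⟩ := exists_proj f s hf hs hcompl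
  let F := Fmap pH pV
  let θ := theta hS F
  have hF : ∀ h t, F (f h) t = h ⊗ₜ t := fun h t => by simp [F, Fmap_apply, h1, h2]
  have hθf : ∀ a (e : H ⊗[k] TensorAlgebra k V), θ (f a) e = a • e := by
    intro a e
    induction e using TensorProduct.induction_on with
    | zero => simp
    | tmul h t => rw [theta_f hS f hf hadj F hF, TensorProduct.smul_tmul', smul_eq_mul]
    | add x y hx hy => rw [map_add, hx, hy, smul_add]
  have hrel : ∀ ⦃u v⦄, fulcrumRel k f u v →
      TensorAlgebra.lift k θ u = TensorAlgebra.lift k θ v := by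
    rintro u v (⟨h, h', rfl, rfl⟩ | ⟨rfl, rfl⟩ | ⟨h, x, rfl, rfl⟩)
    · refine LinearMap.ext fun e => ?_
      simp [hθf, mul_smul]
    · refine LinearMap.ext fun e => ?_
      simp [hθf]
    · apply TensorProduct.ext'
      intro g t
      rw [commRHS_repr f x (ℛ k h)]
      simp only [map_mul, map_sum, TensorAlgebra.lift_ι_apply, Module.End.mul_apply, hθf,
        LinearMap.sum_apply, TensorProduct.smul_tmul', smul_eq_mul]
      exact (theta_rel hS F x h g t).symm
  let ρ := RingQuot.liftAlgHom k ⟨TensorAlgebra.lift k θ, hrel⟩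
  have hρ : ∀ u, ρ (RingQuot.mkAlgHom k (fulcrumRel k f) u) = TensorAlgebra.lift k θ u :=
    fun u => RingQuot.liftAlgHom_mkAlgHom_apply k _ hrel u
  let π := RingQuot.mkAlgHom k (fulcrumRel k f)
  let m : M →ₗ[k] RingQuot (fulcrumRel k f) := π.toLinearMap ∘ₗ TensorAlgebra.ι k
  have mdef : ∀ x, π (TensorAlgebra.ι k x) = m x := fun x => rfl
  have m_mul : ∀ a b, m (f a) * m (f b) = m (f (a * b)) := fun a b => by
    have := RingQuot.mkAlgHom_rel k (s := fulcrumRel k f) (Or.inl ⟨a, b, rfl, rfl⟩)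
    rwa [map_mul] at this
  have m_one : m (f 1) = 1 := by
    have := RingQuot.mkAlgHom_rel k (s := fulcrumRel k f) (Or.inr (Or.inl ⟨rfl, rfl⟩))
    rwa [map_one (RingQuot.mkAlgHom k (fulcrumRel k f))] at this
  have m_comm : ∀ h x, m (f h) * m x =
      ∑ i ∈ (ℛ k h).index, m ((ℛ k h).left i • x) * m (f ((ℛ k h).right i)) := fun h x => by
    have := RingQuot.mkAlgHom_rel k (s := fulcrumRel k f) (Or.inr (Or.inr ⟨h, x, rfl, rfl⟩))
    rw [commRHS_repr f x (ℛ k h), map_sum] at this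
    simp only [map_mul] at this
    exact this
  have m_comm' : ∀ h x, ∑ i ∈ (ℛ k h).index, m (f ((ℛ k h).right i)) *
      m (sinv hS ((ℛ k h).left i) • x) = m x * m (f h) := fun h x => by
    have := collapse_left h
      ((LinearMap.mul k (RingQuot (fulcrumRel k f))).compl₁₂ (m ∘ₗ actL k x) (m ∘ₗ f))
      (mu2 hS) (mu2_spec hS)
    simp only [LinearMap.compl₁₂_apply, LinearMap.comp_apply, LinearMap.mul_apply',
      mu2_apply] at this
    have e : ∀ h : H, actL k x h = h • x := fun _ => rfl
    simp only [e, one_smul] at this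
    rw [← this]
    refine Finset.sum_congr rfl fun i _ => ?_
    rw [m_comm]
    simp only [mul_smul]
  let τ : TensorAlgebra k V →ₐ[k] TensorAlgebra k M :=
    TensorAlgebra.lift k ((TensorAlgebra.ι k (M := M)) ∘ₗ s)
  have hτ : ∀ v, π (τ (TensorAlgebra.ι k v)) = m (s v) := fun v => by
    simp [τ, ← mdef]
  let Ψ : H ⊗[k] TensorAlgebra k V →ₗ[k] RingQuot (fulcrumRel k f) :=
    LinearMap.mul' k (RingQuot (fulcrumRel k f)) ∘ₗ
      TensorProduct.map (m ∘ₗ f) (π.toLinearMap ∘ₗ τ.toLinearMap)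
  have hΨ : ∀ h t, Ψ (h ⊗ₜ t) = m (f h) * π (τ t) := fun h t => rfl
  have hΨs : ∀ a e, Ψ (a • e) = m (f a) * Ψ e := by
    intro a e
    induction e using TensorProduct.induction_on with
    | zero => simp
    | tmul h t => rw [TensorProduct.smul_tmul', smul_eq_mul, hΨ, hΨ, ← m_mul, mul_assoc]
    | add x y hx hy => rw [smul_add, map_add, hx, hy, map_add, mul_add]
  have hΨF : ∀ y t, Ψ (F y t) = m y * π (τ t) := by
    intro y t
    have e : F y t = pH y ⊗ₜ t + 1 ⊗ₜ (TensorAlgebra.ι k (pV y) * t) := rfl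
    rw [e, map_add, hΨ, hΨ, m_one, one_mul, map_mul, map_mul, hτ, ← add_mul, ← map_add, h5]
  have hΨθ : ∀ x e, Ψ (θ x e) = m x * Ψ e := by
    intro x e
    induction e using TensorProduct.induction_on with
    | zero => simp
    | tmul h t =>
      rw [theta_repr hS F x t (ℛ k h), map_sum, hΨ, ← mul_assoc, ← m_comm', Finset.sum_mul]
      refine Finset.sum_congr rfl fun i _ => ?_
      rw [hΨs, hΨF, mul_assoc]
    | add x y hx hy => rw [map_add, map_add, hx, hy, map_add, mul_add]
  have hΨl : ∀ u e, Ψ (TensorAlgebra.lift k θ u e) = π u * Ψ e := by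
    intro u
    induction u using TensorAlgebra.induction with
    | algebraMap r => intro e; simp [Module.algebraMap_end_apply, Algebra.smul_def]
    | ι x => intro e; rw [TensorAlgebra.lift_ι_apply, hΨθ]; rfl
    | mul a b ha hb => intro e; rw [map_mul, Module.End.mul_apply, ha, hb, map_mul, mul_assoc]
    | add a b ha hb => intro e; rw [map_add, LinearMap.add_apply, map_add, ha, hb, map_add, add_mul]
  have hτ1 : ∀ t t', TensorAlgebra.lift k θ (τ t) (1 ⊗ₜ t') = 1 ⊗ₜ (t * t') := by
    intro t
    induction t using TensorAlgebra.induction with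
    | algebraMap r =>
      intro t'
      simp [Module.algebraMap_end_apply, ← Algebra.smul_def]
    | ι v =>
      intro t'
      have e : τ (TensorAlgebra.ι k v) = TensorAlgebra.ι k (s v) := by simp [τ]
      rw [e, TensorAlgebra.lift_ι_apply, theta_one, Fmap_apply, h3, h4]
      simp
    | mul a b ha hb => intro e; rw [map_mul, map_mul, Module.End.mul_apply, hb, ha, mul_assoc]
    | add a b ha hb =>
      intro e
      rw [map_add, map_add, LinearMap.add_apply, ha, hb, add_mul, TensorProduct.tmul_add]
  have hbij : Function.Bijective Ψ := by
    refine Function.bijective_iff_has_inverse.2 ⟨fun b => ρ b (1 ⊗ₜ 1), ?_, ?_⟩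
    · intro e
      show ρ (Ψ e) (1 ⊗ₜ 1) = e
      induction e using TensorProduct.induction_on with
      | zero => simp
      | tmul h t =>
        rw [hΨ, map_mul, ← mdef, hρ, hρ, Module.End.mul_apply, hτ1, TensorAlgebra.lift_ι_apply,
          hθf, TensorProduct.smul_tmul', smul_eq_mul, mul_one, mul_one]
      | add x y hx hy => rw [map_add, map_add, LinearMap.add_apply, hx, hy]
    · intro b
      obtain ⟨u, rfl⟩ := RingQuot.mkAlgHom_surjective k (fulcrumRel k f) b
      show Ψ (ρ _ _) = _
      rw [hρ, hΨl, hΨ, m_one, map_one, map_one, mul_one, mul_one]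
  exact hbij.comp (TensorProduct.comm k (TensorAlgebra k V) H).bijective
end

section
/- Under the fulcrum hypotheses, T(V)#_M H is the internal direct sum, over n ∈ ℕ, of the k-subspaces spanned by the products π(T(s)(a)) · π(ι(f(h))) with a ∈ V^{⊗n} ⊆ T(V) and h ∈ H; that is, T(V)#_M H is a graded vector space whose n-th homogeneous component is the span of (products of n elements of s(V)) times f(H). -/
open TensorProduct

namespace FulcrumAux

section Basic
variable {k H M V : Type*} [Field k] [Ring H] [HopfAlgebra k H]
    [AddCommGroup M] [Module k M] [Module H M] [IsScalarTower k H M]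
    [AddCommGroup V] [Module k V]

/-- Left multiplication by `v ⊗ 1` on `T(V) ⊗ H`. -/
noncomputable def inc (k H : Type*) {V : Type*} [Field k] [Ring H] [HopfAlgebra k H]
    [AddCommGroup V] [Module k V] : V →ₗ[k] TensorAlgebra k V ⊗[k] H :=
  (Algebra.TensorProduct.includeLeft :
    TensorAlgebra k V →ₐ[k] TensorAlgebra k V ⊗[k] H).toLinearMap ∘ₗ TensorAlgebra.ι k

lemma inc_apply (v : V) : inc k H v = TensorAlgebra.ι k v ⊗ₜ (1 : H) := rfl

theorem ta_ind (N : Submodule k (TensorAlgebra k V)) (h1 : 1 ∈ N)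
    (hm : ∀ v, ∀ t ∈ N, TensorAlgebra.ι k v * t ∈ N) (t : TensorAlgebra k V) : t ∈ N := by
  have key : ∀ a : TensorAlgebra k V, ∀ n ∈ N, a * n ∈ N := by
    intro a
    induction a using TensorAlgebra.induction with
    | algebraMap r =>
      intro n hn
      rw [← Algebra.smul_def]; exact N.smul_mem r hn
    | ι v => exact hm v
    | mul a b ha hb => intro n hn; rw [mul_assoc]; exact ha _ (hb _ hn)
    | add a b ha hb => intro n hn; rw [add_mul]; exact N.add_mem (ha _ hn) (hb _ hn)
  simpa using key t 1 h1

theorem B_ind (N : Submodule k (TensorAlgebra k V ⊗[k] H)) (h1 : ∀ a : H, 1 ⊗ₜ a ∈ N)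
    (hm : ∀ v, ∀ t ∈ N, inc k H v * t ∈ N) (t : TensorAlgebra k V ⊗[k] H) : t ∈ N := by
  induction t using TensorProduct.induction_on with
  | zero => exact N.zero_mem
  | add x y hx hy => exact N.add_mem hx hy
  | tmul t a =>
    refine ta_ind (N.comap ((TensorProduct.mk k (TensorAlgebra k V) H).flip a)) (h1 a) ?_ t
    intro v t ht
    have := hm v _ ht
    simpa [inc_apply] using this

/-- `h ↦ Σ h₁ x ⊗ h₂`, linear in `x`. -/
noncomputable def C (k H : Type*) {M : Type*} [Field k] [Ring H] [HopfAlgebra k H]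
    [AddCommGroup M] [Module k M] [Module H M] [IsScalarTower k H M] :
    M →ₗ[k] H →ₗ[k] M ⊗[k] H where
  toFun x := TensorProduct.map (actL k x) LinearMap.id ∘ₗ Coalgebra.comul
  map_add' x y := by
    rw [← LinearMap.add_comp, ← TensorProduct.map_add_left]
    congr 2
    ext h; exact smul_add h x y
  map_smul' c x := by
    simp only [RingHom.id_apply]
    rw [← LinearMap.smul_comp, ← TensorProduct.map_smul_left]
    congr 2
    ext h
    have : SMulCommClass H k M := (IsScalarTower.to_smulCommClass : SMulCommClass k H M).symm
    exact smul_comm h c x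

theorem C_repr (x : M) (h : H) {ι : Type*} (r : Coalgebra.Repr k h ι) :
    C k H x h = ∑ i ∈ r.index, (r.left i • x) ⊗ₜ[k] r.right i := by
  simp only [C, LinearMap.coe_mk, AddHom.coe_mk, LinearMap.comp_apply]
  rw [← r.eq, map_sum]
  rfl

theorem C_mul (x : M) (h h' : H) {ι : Type*} (r : Coalgebra.Repr k h' ι) :
    C k H x (h * h') = ∑ i ∈ r.index,
      LinearMap.lTensor M (LinearMap.mulRight k (r.right i)) (C k H (r.left i • x) h) := by
  let r' := Coalgebra.Repr.arbitrary k h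
  simp only [C_repr _ h r', map_sum, LinearMap.lTensor_tmul, LinearMap.mulRight_apply]
  simp only [C, LinearMap.coe_mk, AddHom.coe_mk, LinearMap.comp_apply]
  rw [Bialgebra.comul_mul, ← r.eq, ← r'.eq, Finset.sum_mul_sum, Finset.sum_comm]
  simp only [map_sum, Algebra.TensorProduct.tmul_mul_tmul, TensorProduct.map_tmul, actL,
    LinearMap.coe_mk, AddHom.coe_mk, LinearMap.id_apply, mul_smul]

theorem C_one (x : M) : C k H x 1 = x ⊗ₜ 1 := by
  simp [C, actL, Algebra.TensorProduct.one_def]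

/-- `Σ ad(h₁)(c) h₂ = h c`. -/
theorem adj_mul (c h : H) :
    LinearMap.mul' k H (TensorProduct.map (adjL k c) LinearMap.id (Coalgebra.comul h)) = h * c := by
  have e : LinearMap.mul' k H ∘ₗ TensorProduct.map (adjL k c) LinearMap.id =
      LinearMap.mul' k H ∘ₗ TensorProduct.map (LinearMap.mulRight k c)
        (LinearMap.mul' k H ∘ₗ (HopfAlgebra.antipode (R := k) (A := H)).rTensor H) ∘ₗ
        (TensorProduct.assoc k H H H).toLinearMap ∘ₗ Coalgebra.comul.rTensor H := by
    ext a b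
    let r := Coalgebra.Repr.arbitrary k a
    simp only [adjL, AlgebraTensorModule.curry_apply, curry_apply, LinearMap.coe_restrictScalars,
      LinearMap.comp_apply, TensorProduct.map_tmul, LinearMap.rTensor_tmul, LinearEquiv.coe_coe]
    rw [← r.eq]
    simp [TensorProduct.sum_tmul, Finset.sum_mul, mul_assoc]
  have := LinearMap.congr_fun e (Coalgebra.comul h)
  simp only [LinearMap.comp_apply, LinearEquiv.coe_coe] at this ⊢
  rw [this, Coalgebra.coassoc_apply]
  let r := Coalgebra.Repr.arbitrary k h
  have hc := Coalgebra.sum_counit_smul r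
  have hc' := Coalgebra.sum_tmul_counit_eq r
  rw [← r.eq]
  simp only [map_sum, LinearMap.lTensor_tmul, TensorProduct.map_tmul, LinearMap.comp_apply,
    HopfAlgebra.mul_antipode_rTensor_comul_apply, LinearMap.mul'_apply, LinearMap.mulRight_apply]
  have h3 := congrArg (fun z => TensorProduct.rid k H z * c) hc'
  simp only [map_sum, TensorProduct.rid_tmul, Finset.sum_mul, one_smul] at h3
  rw [← h3]
  refine Finset.sum_congr rfl fun i _ => ?_
  rw [← Algebra.commutes, ← Algebra.smul_def, smul_mul_assoc]

variable (p : M →ₗ[k] V) (φ : M →ₗ[k] H)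

/-- The bilinear recursion kernel. -/
noncomputable def K : (H →ₗ[k] TensorAlgebra k V ⊗[k] H) →ₗ[k]
    (M ⊗[k] H →ₗ[k] TensorAlgebra k V ⊗[k] H) where
  toFun g := LinearMap.mul' k _ ∘ₗ TensorProduct.map (inc k H ∘ₗ p) g +
    g ∘ₗ LinearMap.mul' k H ∘ₗ TensorProduct.map φ LinearMap.id
  map_add' a b := by ext x h; simp [mul_add]; abel
  map_smul' a b := by ext x h; simp

theorem K_tmul (g : H →ₗ[k] TensorAlgebra k V ⊗[k] H) (x : M) (h : H) :
    K p φ g (x ⊗ₜ h) = inc k H (p x) * g h + g (φ x * h) := by simp [K]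

theorem K_mulRight (g : H →ₗ[k] TensorAlgebra k V ⊗[k] H) (b) :
    K p φ (LinearMap.mulRight k b ∘ₗ g) = LinearMap.mulRight k b ∘ₗ K p φ g := by
  ext x h
  simp [K_tmul, add_mul, mul_assoc]

theorem K_comp (g : H →ₗ[k] TensorAlgebra k V ⊗[k] H) (b : H) (z : M ⊗[k] H) :
    K p φ (g ∘ₗ LinearMap.mulRight k b) z =
      K p φ g (LinearMap.lTensor M (LinearMap.mulRight k b) z) := by
  induction z using TensorProduct.induction_on with
  | zero => simp
  | add x y hx hy => simp only [map_add, hx, hy]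
  | tmul x h => simp [K_tmul, mul_assoc]

theorem K_f (f : H →ₗ[k] M) (hpf : ∀ h, p (f h) = 0) (hφf : ∀ h, φ (f h) = h)
    (hadj : ∀ h a : H, h • f a = f (adjL k a h))
    (g : H →ₗ[k] TensorAlgebra k V ⊗[k] H) (c h : H) :
    K p φ g (C k H (f c) h) = g (h * c) := by
  let r := Coalgebra.Repr.arbitrary k h
  rw [C_repr _ _ r, ← adj_mul (k := k) c h, ← r.eq]
  simp only [map_sum, K_tmul, hadj, hpf, hφf, map_zero, zero_mul, zero_add,
    TensorProduct.map_tmul, LinearMap.mul'_apply, LinearMap.id_apply]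

/-- The recursion operator. -/
noncomputable def A (s : V →ₗ[k] M) : V →ₗ[k] Module.End k (H →ₗ[k] TensorAlgebra k V ⊗[k] H) where
  toFun v :=
    { toFun := fun g => K p φ g ∘ₗ C k H (s v)
      map_add' := fun a b => by rw [map_add, LinearMap.add_comp]
      map_smul' := fun a b => by rw [map_smul, LinearMap.smul_comp]; rfl }
  map_add' a b := by ext g h; simp
  map_smul' a b := by ext g h; simp

theorem A_apply (s : V →ₗ[k] M) (v g) : A p φ s v g = K p φ g ∘ₗ C k H (s v) := rfl

/-- `F t h = f(h) · (t ⊗ 1)`. -/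
noncomputable def F (s : V →ₗ[k] M) : TensorAlgebra k V →ₗ[k] (H →ₗ[k] TensorAlgebra k V ⊗[k] H) :=
  (LinearMap.applyₗ (TensorProduct.mk k (TensorAlgebra k V) H 1)) ∘ₗ
    (TensorAlgebra.lift k (A p φ s)).toLinearMap

theorem F_one (s : V →ₗ[k] M) (h : H) : F p φ s 1 h = 1 ⊗ₜ h := by simp [F]

theorem F_mul (s : V →ₗ[k] M) (v : V) (t) :
    F p φ s (TensorAlgebra.ι k v * t) = K p φ (F p φ s t) ∘ₗ C k H (s v) := by
  simp [F, A_apply]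

/-- `RB w h = f(h) · w`. -/
noncomputable def RB (s : V →ₗ[k] M) :
    TensorAlgebra k V ⊗[k] H →ₗ[k] (H →ₗ[k] TensorAlgebra k V ⊗[k] H) :=
  TensorProduct.lift (LinearMap.mk₂ k
    (fun t a => LinearMap.mulRight k ((1 : TensorAlgebra k V) ⊗ₜ[k] a) ∘ₗ F p φ s t)
    (fun a b c => by ext h; simp [add_mul])
    (fun a b c => by ext h; simp)
    (fun a b c => by ext h; simp [mul_add, TensorProduct.tmul_add])
    (fun a b c => by ext h; simp))

theorem RB_tmul (s : V →ₗ[k] M) (t) (a : H) :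
    RB p φ s (t ⊗ₜ a) = LinearMap.mulRight k ((1 : TensorAlgebra k V) ⊗ₜ[k] a) ∘ₗ F p φ s t := by
  simp [RB]

theorem RB_one (s : V →ₗ[k] M) (a h : H) : RB p φ s (1 ⊗ₜ a) h = 1 ⊗ₜ (h * a) := by
  simp [RB_tmul, F_one]

theorem RB_inc (s : V →ₗ[k] M) (v : V) (w) :
    RB p φ s (inc k H v * w) = K p φ (RB p φ s w) ∘ₗ C k H (s v) := by
  induction w using TensorProduct.induction_on with
  | zero => simp
  | add x y hx hy => rw [mul_add, map_add, map_add, map_add, LinearMap.add_comp, hx, hy]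
  | tmul t a =>
    rw [inc_apply, Algebra.TensorProduct.tmul_mul_tmul, one_mul, RB_tmul, RB_tmul, F_mul,
      K_mulRight, LinearMap.comp_assoc]

variable (f : H →ₗ[k] M) (s : V →ₗ[k] M)

theorem RB_id (hps : ∀ v, p (s v) = v) (hφs : ∀ v, φ (s v) = 0) (w) :
    RB p φ s w 1 = w := by
  refine B_ind (LinearMap.eqLocus ((RB p φ s).flip 1) LinearMap.id) ?_ ?_ w
  · intro a; simp [RB_one]
  · intro v t ht
    simp only [LinearMap.mem_eqLocus, LinearMap.flip_apply, LinearMap.id_apply] at ht ⊢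
    rw [RB_inc, LinearMap.comp_apply, C_one, K_tmul, hps, hφs, ht]
    simp

theorem RB_K (hpf : ∀ h, p (f h) = 0) (hφf : ∀ h, φ (f h) = h)
    (hsf : ∀ x, s (p x) + f (φ x) = x)
    (hadj : ∀ h a : H, h • f a = f (adjL k a h)) (w)
    (IH : ∀ h h', RB p φ s w (h * h') = RB p φ s (RB p φ s w h') h) (x : M) (b h : H) :
    RB p φ s (K p φ (RB p φ s w) (x ⊗ₜ b)) h =
      K p φ (RB p φ s w) (LinearMap.lTensor M (LinearMap.mulRight k b) (C k H x h)) := by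
  have e : RB p φ s (RB p φ s w b) = RB p φ s w ∘ₗ LinearMap.mulRight k b := by
    ext h; simp [IH]
  rw [K_tmul, map_add, RB_inc, LinearMap.add_apply, LinearMap.comp_apply, e, ← IH, K_comp]
  conv_rhs => rw [← hsf x]
  rw [map_add, LinearMap.add_apply, map_add, map_add]
  congr 1
  rw [← K_comp, K_f p φ f hpf hφf hadj]
  simp [mul_assoc]

theorem RB_mul (hpf : ∀ h, p (f h) = 0) (hφf : ∀ h, φ (f h) = h)
    (hsf : ∀ x, s (p x) + f (φ x) = x)
    (hadj : ∀ h a : H, h • f a = f (adjL k a h)) (w) :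
    ∀ h h', RB p φ s w (h * h') = RB p φ s (RB p φ s w h') h := by
  let N : Submodule k (TensorAlgebra k V ⊗[k] H) :=
    { carrier := {w | ∀ h h', RB p φ s w (h * h') = RB p φ s (RB p φ s w h') h}
      add_mem' := fun {a b} ha hb h h' => by
        simp only [Set.mem_ofPred_eq] at ha hb
        simp [ha h h', hb h h']
      zero_mem' := fun h h' => by simp
      smul_mem' := fun c x hx h h' => by
        simp only [Set.mem_ofPred_eq] at hx
        simp [hx h h'] }
  refine B_ind N ?_ ?_ w
  · intro a h h'; simp [RB_one, mul_assoc]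
  · intro v w IH h h'
    change ∀ h h', RB p φ s w (h * h') = RB p φ s (RB p φ s w h') h at IH
    let r := Coalgebra.Repr.arbitrary k h'
    rw [RB_inc, LinearMap.comp_apply, LinearMap.comp_apply, C_mul _ _ _ r, C_repr _ h' r]
    simp only [map_sum, LinearMap.sum_apply]
    refine Finset.sum_congr rfl fun i _ => ?_
    rw [RB_K p φ f s hpf hφf hsf hadj w IH]

/-- The action of `M` on `T(V) ⊗ H`. -/
noncomputable def rho : M →ₗ[k] Module.End k (TensorAlgebra k V ⊗[k] H) :=
  LinearMap.mul k _ ∘ₗ inc k H ∘ₗ p + (RB p φ s).flip ∘ₗ φ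

theorem rho_apply (x : M) (w) :
    rho p φ s x w = inc k H (p x) * w + RB p φ s w (φ x) := rfl

theorem rho_rel (hps : ∀ v, p (s v) = v) (hφs : ∀ v, φ (s v) = 0)
    (hpf : ∀ h, p (f h) = 0) (hφf : ∀ h, φ (f h) = h)
    (hsf : ∀ x, s (p x) + f (φ x) = x)
    (hadj : ∀ h a : H, h • f a = f (adjL k a h)) ⦃u v : TensorAlgebra k M⦄
    (huv : fulcrumRel k f u v) :
    TensorAlgebra.lift k (rho p φ s) u = TensorAlgebra.lift k (rho p φ s) v := by
  have hR := RB_mul p φ f s hpf hφf hsf hadj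
  have h1 := RB_id p φ s hps hφs
  have hf' : ∀ h w, rho p φ s (f h) w = RB p φ s w h := by
    intro h w; rw [rho_apply, hpf, hφf]; simp
  rcases huv with ⟨h, h', rfl, rfl⟩ | ⟨rfl, rfl⟩ | ⟨h, x, rfl, rfl⟩
  · refine LinearMap.ext fun w => ?_
    rw [map_mul, TensorAlgebra.lift_ι_apply, TensorAlgebra.lift_ι_apply,
      TensorAlgebra.lift_ι_apply, Module.End.mul_apply, hf', hf', hf', hR]
  · refine LinearMap.ext fun w => ?_
    rw [TensorAlgebra.lift_ι_apply, hf', h1, map_one]; rfl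
  · refine LinearMap.ext fun w => ?_
    let r := Coalgebra.Repr.arbitrary k h
    have key := RB_K p φ f s hpf hφf hsf hadj w (hR w) x 1 h
    rw [K_tmul, mul_one, h1] at key
    have e1 : LinearMap.lTensor M (LinearMap.mulRight k (1 : H)) (C k H x h) = C k H x h := by
      simp
    rw [e1, C_repr _ _ r] at key
    rw [map_mul, TensorAlgebra.lift_ι_apply, TensorAlgebra.lift_ι_apply, Module.End.mul_apply, hf',
      rho_apply, key]
    simp only [commRHS, LinearMap.comp_apply]
    rw [← r.eq]
    simp only [map_sum, TensorProduct.map_tmul, LinearMap.mul'_apply, LinearMap.comp_apply,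
      map_mul, TensorAlgebra.lift_ι_apply, LinearMap.sum_apply, Module.End.mul_apply, hf', K_tmul]
    refine Finset.sum_congr rfl fun i _ => ?_
    rw [rho_apply, ← hR]
    rfl

end Basic

end FulcrumAux

namespace FulcrumAux

section Final
variable {k H M V : Type*} [Field k] [Ring H] [HopfAlgebra k H]
    [AddCommGroup M] [Module k M] [Module H M] [IsScalarTower k H M]
    [AddCommGroup V] [Module k V]

/-- The map `T(V) ⊗ H → T(V)#_M H`. -/
noncomputable def eta (f : H →ₗ[k] M) (s : V →ₗ[k] M) :
    TensorAlgebra k V ⊗[k] H →ₗ[k] RingQuot (fulcrumRel k f) :=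
  LinearMap.mul' k _ ∘ₗ TensorProduct.map
    ((RingQuot.mkAlgHom k (fulcrumRel k f)).toLinearMap ∘ₗ
      (TensorAlgebra.lift k ((TensorAlgebra.ι k (M := M)) ∘ₗ s)).toLinearMap)
    ((RingQuot.mkAlgHom k (fulcrumRel k f)).toLinearMap ∘ₗ TensorAlgebra.ι k ∘ₗ f)

theorem eta_tmul (f : H →ₗ[k] M) (s : V →ₗ[k] M) (a) (h : H) :
    eta f s (a ⊗ₜ h) = RingQuot.mkAlgHom k (fulcrumRel k f)
                (TensorAlgebra.lift k ((TensorAlgebra.ι k (M := M)) ∘ₗ s) a) *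
              RingQuot.mkAlgHom k (fulcrumRel k f) (TensorAlgebra.ι k (f h)) := rfl

theorem eta_inc (f : H →ₗ[k] M) (s : V →ₗ[k] M) (v : V) (w) :
    eta f s (inc k H v * w) =
      RingQuot.mkAlgHom k (fulcrumRel k f) (TensorAlgebra.ι k (s v)) * eta f s w := by
  induction w using TensorProduct.induction_on with
  | zero => simp
  | add x y hx hy => rw [mul_add, map_add, map_add, mul_add, hx, hy]
  | tmul t a =>
    rw [inc_apply, Algebra.TensorProduct.tmul_mul_tmul, one_mul, eta_tmul, eta_tmul, map_mul,
      map_mul, TensorAlgebra.lift_ι_apply, mul_assoc]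
    rfl

theorem mk_mul (f : H →ₗ[k] M) (h h' : H) :
    RingQuot.mkAlgHom k (fulcrumRel k f) (TensorAlgebra.ι k (f h)) *
      RingQuot.mkAlgHom k (fulcrumRel k f) (TensorAlgebra.ι k (f h')) =
      RingQuot.mkAlgHom k (fulcrumRel k f) (TensorAlgebra.ι k (f (h * h'))) := by
  rw [← map_mul]
  exact RingQuot.mkAlgHom_rel k (Or.inl ⟨h, h', rfl, rfl⟩)

theorem mk_one (f : H →ₗ[k] M) :
    RingQuot.mkAlgHom k (fulcrumRel k f) (TensorAlgebra.ι k (f 1)) = 1 := by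
  rw [← map_one (RingQuot.mkAlgHom k (fulcrumRel k f))]
  exact RingQuot.mkAlgHom_rel k (Or.inr (Or.inl ⟨rfl, rfl⟩))

theorem mk_comm (f : H →ₗ[k] M) (h : H) (x : M) {ι : Type*} (r : Coalgebra.Repr k h ι) :
    RingQuot.mkAlgHom k (fulcrumRel k f) (TensorAlgebra.ι k (f h)) *
      RingQuot.mkAlgHom k (fulcrumRel k f) (TensorAlgebra.ι k x) =
      ∑ i ∈ r.index, RingQuot.mkAlgHom k (fulcrumRel k f) (TensorAlgebra.ι k (r.left i • x)) *
        RingQuot.mkAlgHom k (fulcrumRel k f) (TensorAlgebra.ι k (f (r.right i))) := by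
  have hr : fulcrumRel k f (TensorAlgebra.ι k (f h) * TensorAlgebra.ι k x) (commRHS k f x h) :=
    Or.inr (Or.inr ⟨h, x, rfl, rfl⟩)
  rw [← map_mul, RingQuot.mkAlgHom_rel k hr]
  simp only [commRHS, LinearMap.comp_apply]
  rw [← r.eq]
  simp only [map_sum, TensorProduct.map_tmul, LinearMap.mul'_apply, LinearMap.comp_apply, map_mul]
  rfl

variable (p : M →ₗ[k] V) (φ : M →ₗ[k] H) (f : H →ₗ[k] M) (s : V →ₗ[k] M)

theorem eta_RB (hsf : ∀ x, s (p x) + f (φ x) = x) (w) : ∀ h,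
    eta f s (RB p φ s w h) =
      RingQuot.mkAlgHom k (fulcrumRel k f) (TensorAlgebra.ι k (f h)) * eta f s w := by
  let N : Submodule k (TensorAlgebra k V ⊗[k] H) :=
    { carrier := {w | ∀ h, eta f s (RB p φ s w h) =
        RingQuot.mkAlgHom k (fulcrumRel k f) (TensorAlgebra.ι k (f h)) * eta f s w}
      add_mem' := fun {a b} ha hb h => by
        have h1 := ha h
        have h2 := hb h
        simp only [map_add, LinearMap.add_apply, mul_add, h1, h2]
      zero_mem' := fun h => by simp
      smul_mem' := fun c x hx h => by
        have h1 := hx h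
        simp only [map_smul, LinearMap.smul_apply, mul_smul_comm, h1] }
  refine B_ind N ?_ ?_ w
  · intro a h
    simp [RB_one, eta_tmul, mk_mul]
  · intro v w IH h
    change ∀ h, _ = _ at IH
    let r := Coalgebra.Repr.arbitrary k h
    rw [RB_inc, LinearMap.comp_apply, C_repr _ _ r, eta_inc, ← mul_assoc, mk_comm f h _ r]
    simp only [map_sum, Finset.sum_mul]
    refine Finset.sum_congr rfl fun i _ => ?_
    rw [K_tmul, map_add, eta_inc, IH, IH, ← mk_mul, mul_assoc, ← add_mul, ← map_add, ← map_add,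
      hsf, mul_assoc]

theorem eta_rho (hsf : ∀ x, s (p x) + f (φ x) = x) (x w) :
    eta f s (rho p φ s x w) =
      RingQuot.mkAlgHom k (fulcrumRel k f) (TensorAlgebra.ι k x) * eta f s w := by
  rw [rho_apply, map_add, eta_inc, eta_RB p φ f s hsf, ← add_mul, ← map_add, ← map_add, hsf]

theorem eta_lift (hsf : ∀ x, s (p x) + f (φ x) = x) (t) : ∀ w,
    eta f s (TensorAlgebra.lift k (rho p φ s) t w) =
      RingQuot.mkAlgHom k (fulcrumRel k f) t * eta f s w := by
  induction t using TensorAlgebra.induction with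
  | algebraMap r =>
    intro w
    rw [AlgHom.commutes, AlgHom.commutes, Module.algebraMap_end_apply, map_smul, Algebra.smul_def]
  | ι x => intro w; rw [TensorAlgebra.lift_ι_apply, eta_rho p φ f s hsf]
  | mul a b ha hb => intro w; rw [map_mul, map_mul, Module.End.mul_apply, ha, hb, mul_assoc]
  | add a b ha hb =>
    intro w; rw [map_add, map_add, LinearMap.add_apply, map_add, ha, hb, add_mul]

theorem eta_surj (hsf : ∀ x, s (p x) + f (φ x) = x) : Function.Surjective (eta f s) := by
  intro q
  obtain ⟨t, rfl⟩ := RingQuot.mkAlgHom_surjective k (fulcrumRel k f) q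
  refine ⟨TensorAlgebra.lift k (rho p φ s) t (1 ⊗ₜ 1), ?_⟩
  rw [eta_lift p φ f s hsf, eta_tmul, mk_one]
  simp

theorem lift_s (hps : ∀ v, p (s v) = v) (hφs : ∀ v, φ (s v) = 0) (t : TensorAlgebra k V) : ∀ w,
    TensorAlgebra.lift k (rho p φ s)
      (TensorAlgebra.lift k ((TensorAlgebra.ι k (M := M)) ∘ₗ s) t) w =
    (t ⊗ₜ[k] (1 : H)) * w := by
  induction t using TensorAlgebra.induction with
  | algebraMap r =>
    intro w
    rw [AlgHom.commutes, AlgHom.commutes, Module.algebraMap_end_apply, Algebra.smul_def]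
    rfl
  | ι x =>
    intro w
    rw [TensorAlgebra.lift_ι_apply, LinearMap.comp_apply, TensorAlgebra.lift_ι_apply, rho_apply,
      hps, hφs, map_zero, add_zero, inc_apply]
  | mul a b ha hb =>
    intro w
    rw [map_mul, map_mul, Module.End.mul_apply, ha, hb, ← mul_assoc,
      Algebra.TensorProduct.tmul_mul_tmul, mul_one]
  | add a b ha hb =>
    intro w; rw [map_add, map_add, LinearMap.add_apply, ha, hb, TensorProduct.add_tmul, add_mul]

/-- A left inverse of `eta`. -/
theorem exists_theta (hps : ∀ v, p (s v) = v) (hφs : ∀ v, φ (s v) = 0)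
    (hpf : ∀ h, p (f h) = 0) (hφf : ∀ h, φ (f h) = h)
    (hsf : ∀ x, s (p x) + f (φ x) = x)
    (hadj : ∀ h a : H, h • f a = f (adjL k a h)) :
    ∃ θ : RingQuot (fulcrumRel k f) →ₗ[k] TensorAlgebra k V ⊗[k] H,
      ∀ w, θ (eta f s w) = w := by
  let ψ := RingQuot.liftAlgHom k (s := fulcrumRel k f)
    ⟨TensorAlgebra.lift k (rho p φ s), rho_rel p φ f s hps hφs hpf hφf hsf hadj⟩
  have hψ : ∀ t, ψ (RingQuot.mkAlgHom k (fulcrumRel k f) t) =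
      TensorAlgebra.lift k (rho p φ s) t := fun t =>
    RingQuot.liftAlgHom_mkAlgHom_apply k _ _ t
  refine ⟨LinearMap.applyₗ (1 ⊗ₜ 1) ∘ₗ ψ.toLinearMap, fun w => ?_⟩
  induction w using TensorProduct.induction_on with
  | zero => simp
  | add x y hx hy => rw [map_add, map_add, hx, hy]
  | tmul t a =>
    rw [eta_tmul]
    simp only [LinearMap.comp_apply, AlgHom.toLinearMap_apply, LinearMap.applyₗ_apply_apply]
    rw [map_mul, hψ, hψ, Module.End.mul_apply, lift_s p φ s hps hφs, TensorAlgebra.lift_ι_apply,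
      rho_apply, hpf, hφf, RB_one]
    simp

end Final

end FulcrumAux

/-- Under the fulcrum hypotheses, `T(V)#_M H` is the internal direct sum,
over `n ∈ ℕ`, of the subspaces spanned by the products `π(T(s)(a)) · π(ι(f(h)))` with
`a ∈ V^{⊗n} ⊆ T(V)` and `h ∈ H`. -/
theorem fulcrum_graded
    {k H M V : Type*} [Field k] [Ring H] [HopfAlgebra k H]
    [AddCommGroup M] [Module k M] [Module H M] [IsScalarTower k H M]
    [AddCommGroup V] [Module k V]
    (f : H →ₗ[k] M) (s : V →ₗ[k] M)
    (hf : Function.Injective f) (hs : Function.Injective s)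
    (hS : Function.Bijective (HopfAlgebra.antipode (R := k) (A := H)))
    (hadj : ∀ h a : H, h • f a = f (adjL k a h))
    (hcompl : IsCompl (LinearMap.range f) (LinearMap.range s)) :
    DirectSum.IsInternal (fun n : ℕ =>
      Submodule.span k { q : RingQuot (fulcrumRel k f) |
        ∃ a ∈ (LinearMap.range (TensorAlgebra.ι k : V →ₗ[k] TensorAlgebra k V)) ^ n,
        ∃ h : H,
          q = RingQuot.mkAlgHom k (fulcrumRel k f)
                (TensorAlgebra.lift k ((TensorAlgebra.ι k (M := M)) ∘ₗ s) a) *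
              RingQuot.mkAlgHom k (fulcrumRel k f) (TensorAlgebra.ι k (f h)) }) := by
  classical
  -- the projections of `M`
  let e : (H × V) ≃ₗ[k] M := LinearEquiv.ofBijective (f.coprod s) (by
    constructor
    · rw [← LinearMap.ker_eq_bot, LinearMap.ker_coprod_of_disjoint_range _ _ hcompl.disjoint,
        LinearMap.ker_eq_bot.2 hf, LinearMap.ker_eq_bot.2 hs, Submodule.prod_bot]
    · rw [← LinearMap.range_eq_top, LinearMap.range_coprod]
      exact hcompl.sup_eq_top)
  have he : ∀ a b, e (a, b) = f a + s b := fun a b => LinearMap.coprod_apply f s (a, b)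
  let p : M →ₗ[k] V := LinearMap.snd k H V ∘ₗ e.symm.toLinearMap
  let φ : M →ₗ[k] H := LinearMap.fst k H V ∘ₗ e.symm.toLinearMap
  have es : ∀ v, e.symm (s v) = (0, v) := fun v => by
    rw [LinearEquiv.symm_apply_eq, he]; simp
  have ef : ∀ h, e.symm (f h) = (h, 0) := fun v => by
    rw [LinearEquiv.symm_apply_eq, he]; simp
  have hps : ∀ v, p (s v) = v := fun v => by simp [p, es]
  have hφs : ∀ v, φ (s v) = 0 := fun v => by simp [φ, es]
  have hpf : ∀ h, p (f h) = 0 := fun v => by simp [p, ef]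
  have hφf : ∀ h, φ (f h) = h := fun v => by simp [φ, ef]
  have hsf : ∀ x, s (p x) + f (φ x) = x := fun x => by
    rw [add_comm, ← he]; exact e.apply_symm_apply x
  have hsurj := FulcrumAux.eta_surj p φ f s hsf
  obtain ⟨θ, hθ⟩ := FulcrumAux.exists_theta p φ f s hps hφs hpf hφf hsf hadj
  have hθ' : ∀ q, FulcrumAux.eta f s (θ q) = q := fun q => by
    obtain ⟨w, rfl⟩ := hsurj q
    rw [hθ]
  let 𝒜 : ℕ → Submodule k (TensorAlgebra k V) := fun n =>
    (LinearMap.range (TensorAlgebra.ι k : V →ₗ[k] TensorAlgebra k V)) ^ n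
  have : GradedAlgebra 𝒜 := TensorAlgebra.gradedAlgebra
  let pr : ℕ → (TensorAlgebra k V ⊗[k] H →ₗ[k] TensorAlgebra k V ⊗[k] H) := fun m =>
    LinearMap.rTensor H (GradedAlgebra.proj 𝒜 m)
  rw [DirectSum.isInternal_submodule_iff_iSupIndep_and_iSup_eq_top]
  constructor
  · rw [iSupIndep_def]
    intro m
    rw [Submodule.disjoint_def]
    intro x hx hx'
    have h1 : pr m (θ x) = θ x := by
      refine (Submodule.span_le (p := LinearMap.eqLocus (pr m ∘ₗ θ) θ)).2 ?_ hx
      rintro _ ⟨a, ha, h, rfl⟩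
      simp only [SetLike.mem_coe, LinearMap.mem_eqLocus, LinearMap.comp_apply]
      rw [← FulcrumAux.eta_tmul, hθ]
      simp only [pr, LinearMap.rTensor_tmul, GradedAlgebra.proj_apply]
      rw [DirectSum.decompose_of_mem_same 𝒜 ha]
    have h2 : pr m (θ x) = 0 := by
      have hle := iSup₂_le (f := fun (j : ℕ) (_ : j ≠ m) => Submodule.span k { q : RingQuot (fulcrumRel k f) |
        ∃ a ∈ (LinearMap.range (TensorAlgebra.ι k : V →ₗ[k] TensorAlgebra k V)) ^ j,
        ∃ h : H,
          q = RingQuot.mkAlgHom k (fulcrumRel k f)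
                (TensorAlgebra.lift k ((TensorAlgebra.ι k (M := M)) ∘ₗ s) a) *
              RingQuot.mkAlgHom k (fulcrumRel k f) (TensorAlgebra.ι k (f h)) })
        (a := LinearMap.ker (pr m ∘ₗ θ)) (by
          intro j hj
          rw [Submodule.span_le]
          rintro _ ⟨a, ha, h, rfl⟩
          simp only [SetLike.mem_coe, LinearMap.mem_ker, LinearMap.comp_apply]
          rw [← FulcrumAux.eta_tmul, hθ]
          simp only [pr, LinearMap.rTensor_tmul, GradedAlgebra.proj_apply]
          rw [DirectSum.decompose_of_mem_ne 𝒜 ha hj, TensorProduct.zero_tmul])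
      exact hle hx'
    rw [← hθ' x, ← h1, h2, map_zero]
  · rw [eq_top_iff]
    rintro q -
    obtain ⟨w, rfl⟩ := hsurj q
    induction w using TensorProduct.induction_on with
    | zero => rw [map_zero]; exact Submodule.zero_mem _
    | add x y hx hy => rw [map_add]; exact Submodule.add_mem _ hx hy
    | tmul t a =>
      rw [← DirectSum.sum_support_decompose 𝒜 t, TensorProduct.sum_tmul, map_sum]
      refine Submodule.sum_mem _ fun i _ => ?_
      refine Submodule.mem_iSup_of_mem i (Submodule.subset_span ?_)
      exact ⟨_, (DirectSum.decompose 𝒜 t i).2, a, FulcrumAux.eta_tmul f s _ a⟩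
end

section
/- Under the presentation hypotheses, if μ satisfies μ(i,j) = μ(i▷j, i) = μ(j, i▷j) for all i, j (condition eq:mij) and μ(i,j) + μ(k▷i, k▷j) = λ(k,i)(λ(k,i▷j) + λ(i,j)) + λ(k,j)(λ(k,i) + λ(j,i▷j)) + λ(k,i▷j)(λ(k,j) + λ(i▷j,i)) for all i, j, k (condition eq:rel), then the family of elements w·X_g of L_{λμ}, where g ranges over G and w ranges over the 12 monomials m₁m₂m₃ with m₁ ∈ {1, x₀}, m₂ ∈ {1, x₁, x₁x₀}, m₃ ∈ {1, x₂}, is a k-basis of L_{λμ}; in particular L_{λμ} is isomorphic as a k-vector space to FK₃ ⊗ kG, which is the linear content of the statement that L_{λμ} is a lifting of the Fomin–Kirillov algebra FK₃ over kG. -/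
/-- The rack operation `i ▷ j = 2i − j` on `ZMod 3`. -/
def rackOp (i j : ZMod 3) : ZMod 3 := 2 * i - j

/-- The defining relations of the algebra `L_{λμ}`: `X_g X_h = X_{gh}`, `X_1 = 1`,
`X_g x_i = (x_{ρ(g)(i)} + b(g,i)(1 + X_{g_{ρ(g)(i)}})) X_g`, and the deformed quadratic
relations `x_i x_j + x_{i▷j} x_i + x_j x_{i▷j} + λ(i,j) x_i + λ(i▷j,i) x_{i▷j}
+ λ(j,i▷j) x_j + μ(i,j)(1 + X_{g_i g_j}) = 0`. -/
def LRel (k : Type*) [Field k] {G : Type*} [Group G] (g : ZMod 3 → G)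
    (ρ : G →* Equiv.Perm (ZMod 3)) (b : G → ZMod 3 → k) (μ : ZMod 3 → ZMod 3 → k)
    (u v : FreeAlgebra k (G ⊕ ZMod 3)) : Prop :=
  (∃ a c : G, u = FreeAlgebra.ι k (Sum.inl a) * FreeAlgebra.ι k (Sum.inl c) ∧
      v = FreeAlgebra.ι k (Sum.inl (a * c))) ∨
  (u = FreeAlgebra.ι k (Sum.inl (1 : G)) ∧ v = 1) ∨
  (∃ (a : G) (i : ZMod 3),
      u = FreeAlgebra.ι k (Sum.inl a) * FreeAlgebra.ι k (Sum.inr i) ∧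
      v = (FreeAlgebra.ι k (Sum.inr (ρ a i)) +
            b a i • (1 + FreeAlgebra.ι k (Sum.inl (g (ρ a i))))) *
            FreeAlgebra.ι k (Sum.inl a)) ∨
  (∃ i j : ZMod 3,
      u = FreeAlgebra.ι k (Sum.inr i) * FreeAlgebra.ι k (Sum.inr j) +
            FreeAlgebra.ι k (Sum.inr (rackOp i j)) * FreeAlgebra.ι k (Sum.inr i) +
            FreeAlgebra.ι k (Sum.inr j) * FreeAlgebra.ι k (Sum.inr (rackOp i j)) +
            b (g i) j • FreeAlgebra.ι k (Sum.inr i) +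
            b (g (rackOp i j)) i • FreeAlgebra.ι k (Sum.inr (rackOp i j)) +
            b (g j) (rackOp i j) • FreeAlgebra.ι k (Sum.inr j) +
            μ i j • (1 + FreeAlgebra.ι k (Sum.inl (g i * g j))) ∧
      v = 0)


namespace FKL

def dg : Fin 12 → ℕ := ![0,1,1,2,2,3,1,2,2,3,3,4]

def F0 {k : Type*} [Field k] (c m _n : k) (v : Fin 12 → k) : Fin 12 → k :=
  ![(m)*v 6,
    (m)*v 7,
    (m)*v 8,
    (m)*v 9,
    (m)*v 10,
    (m)*v 11,
    v 0 + (c)*v 6,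
    v 1 + (c)*v 7,
    v 2 + (c)*v 8,
    v 3 + (c)*v 9,
    v 4 + (c)*v 10,
    v 5 + (c)*v 11]

def M0 {k : Type*} [Field k] (c m n : k) : Module.End k (Fin 12 → k) where
  toFun := F0 c m n
  map_add' := by
    intro v w
    ext j
    fin_cases j <;> simp [F0] <;> ring
  map_smul' := by
    intro v w
    ext j
    fin_cases j <;> simp [F0] <;> ring

def F1 {k : Type*} [Field k] (c m n : k) (v : Fin 12 → k) : Fin 12 → k :=
  ![(m)*v 2 + (m*n + c^2*m)*v 10,
    (m)*v 3 + (m*n + c^2*m)*v 11,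
    v 0 + (c)*v 2 + (n + c^2)*v 8,
    v 1 + (c)*v 3 + (n + c^2)*v 9,
    (c)*v 4 + v 6 + (n + c^2)*v 10,
    (c)*v 5 + v 7 + (n + c^2)*v 11,
    (m)*v 4 + (n + c^2)*v 8 + (c*n + c^3)*v 10,
    (m)*v 5 + (n + c^2)*v 9 + (c*n + c^3)*v 11,
    (m)*v 10,
    (m)*v 11,
    v 8 + (c)*v 10,
    v 9 + (c)*v 11]

def M1 {k : Type*} [Field k] (c m n : k) : Module.End k (Fin 12 → k) where
  toFun := F1 c m n
  map_add' := by
    intro v w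
    ext j
    fin_cases j <;> simp [F1] <;> ring
  map_smul' := by
    intro v w
    ext j
    fin_cases j <;> simp [F1] <;> ring

def F2 {k : Type*} [Field k] (c m n : k) (v : Fin 12 → k) : Fin 12 → k :=
  ![(m)*v 1 + (n)*v 2 + (c*m)*v 3 + (c*n)*v 4 + (c^2*m)*v 5 + (n)*v 6 + (c*m)*v 7 + (c*n)*v 8 + (c^2*m)*v 9 + (m^2 + c^2*n + c^2*m)*v 10 + (c*m^2 + c^3*m)*v 11,
    v 0 + (c)*v 1 + (c)*v 2 + (n + c^2)*v 3 + (c^2)*v 4 + (c*n + c^3)*v 5 + (c)*v 6 + (n + c^2)*v 7 + (c^2)*v 8 + (c*n + c^3)*v 9 + (c*m + c^3)*v 10 + (m^2 + c^2*n + c^4)*v 11,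
    (c)*v 2 + (c^2)*v 4 + (c*m)*v 5 + (c)*v 6 + (m)*v 7 + (c^2)*v 8 + (c*m)*v 9 + (c^3)*v 10 + (m*n)*v 11,
    (c)*v 3 + (c)*v 4 + v 6 + (c)*v 8 + (n)*v 10 + (c*n + c^3)*v 11,
    v 2 + (c)*v 8 + (m)*v 9 + (n)*v 10 + (c*m)*v 11,
    v 3 + v 8 + (c)*v 10 + (n + c^2)*v 11,
    (c)*v 2 + (m)*v 3 + (c^2)*v 4 + (c*m)*v 5 + (c)*v 6 + (c^2)*v 8 + (c*m)*v 9 + (c*n)*v 10 + (m*n)*v 11,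
    v 2 + (c)*v 4 + (c)*v 7 + (c)*v 8 + (n)*v 10,
    (c)*v 4 + (m)*v 5 + v 6 + (c^2)*v 10 + (c*m)*v 11,
    v 4 + v 7 + (c)*v 10,
    (c)*v 10 + (m)*v 11,
    v 10]

def M2 {k : Type*} [Field k] (c m n : k) : Module.End k (Fin 12 → k) where
  toFun := F2 c m n
  map_add' := by
    intro v w
    ext j
    fin_cases j <;> simp [F2] <;> ring
  map_smul' := by
    intro v w
    ext j
    fin_cases j <;> simp [F2] <;> ring


theorem M0_sq {k : Type*} [Field k] [CharP k 2] (c m n : k) :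
    M0 c m n * M0 c m n + c • M0 c m n + m • 1 = 0 := by
  have h2 : (2 : k) = 0 := CharTwo.two_eq_zero
  refine LinearMap.ext fun v => funext fun j => ?_
  fin_cases j <;> simp [M0, F0] <;> grind

theorem M1_sq {k : Type*} [Field k] [CharP k 2] (c m n : k) :
    M1 c m n * M1 c m n + c • M1 c m n + m • 1 = 0 := by
  have h2 : (2 : k) = 0 := CharTwo.two_eq_zero
  refine LinearMap.ext fun v => funext fun j => ?_
  fin_cases j <;> simp [M1, F1] <;> grind

theorem M2_sq {k : Type*} [Field k] [CharP k 2] (c m n : k) :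
    M2 c m n * M2 c m n + c • M2 c m n + m • 1 = 0 := by
  have h2 : (2 : k) = 0 := CharTwo.two_eq_zero
  refine LinearMap.ext fun v => funext fun j => ?_
  fin_cases j <;> simp [M2, F2] <;> grind

theorem M_01 {k : Type*} [Field k] [CharP k 2] (c m n : k) :
    M0 c m n * M1 c m n + M2 c m n * M0 c m n + M1 c m n * M2 c m n +
    c • (M0 c m n + M1 c m n + M2 c m n) + n • 1 = 0 := by
  have h2 : (2 : k) = 0 := CharTwo.two_eq_zero
  refine LinearMap.ext fun v => funext fun j => ?_
  fin_cases j <;> simp [M0, M1, M2, F0, F1, F2] <;> grind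

theorem M_10 {k : Type*} [Field k] [CharP k 2] (c m n : k) :
    M1 c m n * M0 c m n + M2 c m n * M1 c m n + M0 c m n * M2 c m n +
    c • (M0 c m n + M1 c m n + M2 c m n) + n • 1 = 0 := by
  have h2 : (2 : k) = 0 := CharTwo.two_eq_zero
  refine LinearMap.ext fun v => funext fun j => ?_
  fin_cases j <;> simp [M0, M1, M2, F0, F1, F2] <;> grind

theorem M_deg {k : Type*} [Field k] (c m n : k) (d : ℕ) (v : Fin 12 → k)
    (hv : ∀ j, d ≤ dg j → v j = 0) (j : Fin 12) (hj : d + 1 ≤ dg j) :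
    M0 c m n v j = 0 ∧ M1 c m n v j = 0 ∧ M2 c m n v j = 0 := by
  have h0 : d ≤ 0 → v 0 = 0 := hv 0
  have h1 : d ≤ 1 → v 1 = 0 := hv 1
  have h2 : d ≤ 1 → v 2 = 0 := hv 2
  have h3 : d ≤ 2 → v 3 = 0 := hv 3
  have h4 : d ≤ 2 → v 4 = 0 := hv 4
  have h5 : d ≤ 3 → v 5 = 0 := hv 5
  have h6 : d ≤ 1 → v 6 = 0 := hv 6
  have h7 : d ≤ 2 → v 7 = 0 := hv 7
  have h8 : d ≤ 2 → v 8 = 0 := hv 8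
  have h9 : d ≤ 3 → v 9 = 0 := hv 9
  have h10 : d ≤ 3 → v 10 = 0 := hv 10
  have h11 : d ≤ 4 → v 11 = 0 := hv 11
  clear hv
  fin_cases j <;> simp only [dg] at hj <;> simp at hj <;>
    refine ⟨?_, ?_, ?_⟩ <;> simp [M0, M1, M2, F0, F1, F2] <;> grind

end FKL


namespace FKL

section Span

variable {k : Type*} [Field k] {A : Type*} [Ring A] [Algebra k A]

/-- The twelve normal monomials. -/
def ww (x0 x1 x2 : A) (a : Fin 2) (b : Fin 3) (c : Fin 2) : A :=
  (![1, x0] a) * (![1, x1, x1 * x0] b) * (![1, x2] c)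

/-- The degree of a normal monomial. -/
def wd (a : Fin 2) (b : Fin 3) (c : Fin 2) : ℕ := a.val + b.val + c.val

/-- Span of the normal monomials of bounded degree. -/
def wsp (k : Type*) [Field k] {A : Type*} [Ring A] [Algebra k A] (x0 x1 x2 : A) (n : ℕ) :
    Submodule k A :=
  Submodule.span k {y | ∃ a b c, wd a b c ≤ n ∧ ww x0 x1 x2 a b c = y}

theorem m1 (V : Submodule k A) {u : A} (h : u ∈ V) : u ∈ V ^ 1 := by simpa using h

theorem ms (V : Submodule k A) {u v : A} {n : ℕ} (h : u ∈ V ^ n) (h' : v ∈ V) :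
    u * v ∈ V ^ (n + 1) := by
  rw [pow_succ]; exact Submodule.mul_mem_mul h h'

theorem mt (V : Submodule k A) {u v : A} {n : ℕ} (h : u ∈ V ^ n) (h' : v ∈ V ^ 2) :
    u * v ∈ V ^ (n + 2) := by
  rw [pow_add]; exact Submodule.mul_mem_mul h h'

theorem hw {x0 x1 x2 : A} (a : Fin 2) (b : Fin 3) (c : Fin 2) (n : ℕ) {y : A}
    (h : ww x0 x1 x2 a b c = y) (h' : wd a b c ≤ n) : y ∈ wsp k x0 x1 x2 n :=
  Submodule.subset_span ⟨a, b, c, h', h⟩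

set_option maxHeartbeats 1000000 in
theorem red_all (V : Submodule k A) (x0 x1 x2 : A) (h0 : x0 ∈ V) (h1 : x1 ∈ V) (h2 : x2 ∈ V)
    (hq0 : x0 * x0 ∈ V) (hq1 : x1 * x1 ∈ V) (hq2 : x2 * x2 ∈ V)
    (hr : x0 * x1 + x2 * x0 + x1 * x2 ∈ V) (hs : x1 * x0 + x2 * x1 + x0 * x2 ∈ V)
    (a : Fin 2) (b : Fin 3) (c : Fin 2) :
    (ww x0 x1 x2 a b c * x0 ∈ wsp k x0 x1 x2 (wd a b c + 1) ⊔ V ^ wd a b c) ∧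
    (ww x0 x1 x2 a b c * x1 ∈ wsp k x0 x1 x2 (wd a b c + 1) ⊔ V ^ wd a b c) ∧
    (ww x0 x1 x2 a b c * x2 ∈ wsp k x0 x1 x2 (wd a b c + 1) ⊔ V ^ wd a b c) := by
  have ht : x1 * x0 * x1 - x0 * x1 * x0 ∈ V ^ 2 := by
    have e : x1 * x0 * x1 - x0 * x1 * x0 = (x1 * x0 + x2 * x1 + x0 * x2) * x1 - x2 * (x1 * x1)
        - x0 * (x1 * x0 + x2 * x1 + x0 * x2) + (x0 * x0) * x2 := by noncomm_ring
    rw [e]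
    exact add_mem (sub_mem (sub_mem (ms V (m1 V hs) h1) (ms V (m1 V h2) hq1))
      (ms V (m1 V h0) hs)) (ms V (m1 V hq0) h2)
  have c0000 : ww x0 x1 x2 0 0 0 * x0 ∈ wsp k x0 x1 x2 (0 + 1) ⊔ V ^ 0 := by
    have e : ww x0 x1 x2 0 0 0 * x0 = (x0) := by
      simp [ww] <;> noncomm_ring
    rw [e]
    exact (Submodule.mem_sup_left (hw 1 0 0 _ (by simp [ww, mul_assoc]) (by simp [wd])))
  have c0001 : ww x0 x1 x2 0 0 0 * x1 ∈ wsp k x0 x1 x2 (0 + 1) ⊔ V ^ 0 := by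
    have e : ww x0 x1 x2 0 0 0 * x1 = (x1) := by
      simp [ww] <;> noncomm_ring
    rw [e]
    exact (Submodule.mem_sup_left (hw 0 1 0 _ (by simp [ww, mul_assoc]) (by simp [wd])))
  have c0002 : ww x0 x1 x2 0 0 0 * x2 ∈ wsp k x0 x1 x2 (0 + 1) ⊔ V ^ 0 := by
    have e : ww x0 x1 x2 0 0 0 * x2 = (x2) := by
      simp [ww] <;> noncomm_ring
    rw [e]
    exact (Submodule.mem_sup_left (hw 0 0 1 _ (by simp [ww, mul_assoc]) (by simp [wd])))
  have c0010 : ww x0 x1 x2 0 0 1 * x0 ∈ wsp k x0 x1 x2 (1 + 1) ⊔ V ^ 1 := by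
    have e : ww x0 x1 x2 0 0 1 * x0 = -(x1 * x2) - (x0 * x1) + ((x0 * x1 + x2 * x0 + x1 * x2)) := by
      simp [ww] <;> noncomm_ring
    rw [e]
    exact (add_mem (sub_mem (neg_mem (Submodule.mem_sup_left (hw 0 1 1 _ (by simp [ww, mul_assoc]) (by simp [wd]))))
      (Submodule.mem_sup_left (hw 1 1 0 _ (by simp [ww, mul_assoc]) (by simp [wd]))))
      (Submodule.mem_sup_right (m1 V hr)))
  have c0011 : ww x0 x1 x2 0 0 1 * x1 ∈ wsp k x0 x1 x2 (1 + 1) ⊔ V ^ 1 := by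
    have e : ww x0 x1 x2 0 0 1 * x1 = -(x0 * x2) - (x1 * x0) + ((x1 * x0 + x2 * x1 + x0 * x2)) := by
      simp [ww] <;> noncomm_ring
    rw [e]
    exact (add_mem (sub_mem (neg_mem (Submodule.mem_sup_left (hw 1 0 1 _ (by simp [ww, mul_assoc]) (by simp [wd]))))
      (Submodule.mem_sup_left (hw 0 2 0 _ (by simp [ww, mul_assoc]) (by simp [wd]))))
      (Submodule.mem_sup_right (m1 V hs)))
  have c0012 : ww x0 x1 x2 0 0 1 * x2 ∈ wsp k x0 x1 x2 (1 + 1) ⊔ V ^ 1 := by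
    have e : ww x0 x1 x2 0 0 1 * x2 = ((x2 * x2)) := by
      simp [ww] <;> noncomm_ring
    rw [e]
    exact (Submodule.mem_sup_right (m1 V hq2))
  have c0100 : ww x0 x1 x2 0 1 0 * x0 ∈ wsp k x0 x1 x2 (1 + 1) ⊔ V ^ 1 := by
    have e : ww x0 x1 x2 0 1 0 * x0 = (x1 * x0) := by
      simp [ww] <;> noncomm_ring
    rw [e]
    exact (Submodule.mem_sup_left (hw 0 2 0 _ (by simp [ww, mul_assoc]) (by simp [wd])))
  have c0101 : ww x0 x1 x2 0 1 0 * x1 ∈ wsp k x0 x1 x2 (1 + 1) ⊔ V ^ 1 := by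
    have e : ww x0 x1 x2 0 1 0 * x1 = ((x1 * x1)) := by
      simp [ww] <;> noncomm_ring
    rw [e]
    exact (Submodule.mem_sup_right (m1 V hq1))
  have c0102 : ww x0 x1 x2 0 1 0 * x2 ∈ wsp k x0 x1 x2 (1 + 1) ⊔ V ^ 1 := by
    have e : ww x0 x1 x2 0 1 0 * x2 = (x1 * x2) := by
      simp [ww] <;> noncomm_ring
    rw [e]
    exact (Submodule.mem_sup_left (hw 0 1 1 _ (by simp [ww, mul_assoc]) (by simp [wd])))
  have c0110 : ww x0 x1 x2 0 1 1 * x0 ∈ wsp k x0 x1 x2 (2 + 1) ⊔ V ^ 2 := by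
    have e : ww x0 x1 x2 0 1 1 * x0 = -(x0 * x1 * x0) + (x1 * (x0 * x1 + x2 * x0 + x1 * x2)) - ((x1 * x1) * x2) - ((x1 * x0 * x1 - x0 * x1 * x0)) := by
      simp [ww] <;> noncomm_ring
    rw [e]
    exact (sub_mem (sub_mem (add_mem (neg_mem (Submodule.mem_sup_left (hw 1 2 0 _ (by simp [ww, mul_assoc]) (by simp [wd]))))
      (Submodule.mem_sup_right (ms V (m1 V h1) hr)))
      (Submodule.mem_sup_right (ms V (m1 V hq1) h2)))
      (Submodule.mem_sup_right ht))
  have c0111 : ww x0 x1 x2 0 1 1 * x1 ∈ wsp k x0 x1 x2 (2 + 1) ⊔ V ^ 2 := by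
    have e : ww x0 x1 x2 0 1 1 * x1 = -(x1 * x0 * x2) + (x1 * (x1 * x0 + x2 * x1 + x0 * x2)) - ((x1 * x1) * x0) := by
      simp [ww] <;> noncomm_ring
    rw [e]
    exact (sub_mem (add_mem (neg_mem (Submodule.mem_sup_left (hw 0 2 1 _ (by simp [ww, mul_assoc]) (by simp [wd]))))
      (Submodule.mem_sup_right (ms V (m1 V h1) hs)))
      (Submodule.mem_sup_right (ms V (m1 V hq1) h0)))
  have c0112 : ww x0 x1 x2 0 1 1 * x2 ∈ wsp k x0 x1 x2 (2 + 1) ⊔ V ^ 2 := by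
    have e : ww x0 x1 x2 0 1 1 * x2 = (x1 * (x2 * x2)) := by
      simp [ww] <;> noncomm_ring
    rw [e]
    exact (Submodule.mem_sup_right (ms V (m1 V h1) hq2))
  have c0200 : ww x0 x1 x2 0 2 0 * x0 ∈ wsp k x0 x1 x2 (2 + 1) ⊔ V ^ 2 := by
    have e : ww x0 x1 x2 0 2 0 * x0 = (x1 * (x0 * x0)) := by
      simp [ww] <;> noncomm_ring
    rw [e]
    exact (Submodule.mem_sup_right (ms V (m1 V h1) hq0))
  have c0201 : ww x0 x1 x2 0 2 0 * x1 ∈ wsp k x0 x1 x2 (2 + 1) ⊔ V ^ 2 := by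
    have e : ww x0 x1 x2 0 2 0 * x1 = (x0 * x1 * x0) + ((x1 * x0 * x1 - x0 * x1 * x0)) := by
      simp [ww] <;> noncomm_ring
    rw [e]
    exact (add_mem (Submodule.mem_sup_left (hw 1 2 0 _ (by simp [ww, mul_assoc]) (by simp [wd])))
      (Submodule.mem_sup_right ht))
  have c0202 : ww x0 x1 x2 0 2 0 * x2 ∈ wsp k x0 x1 x2 (2 + 1) ⊔ V ^ 2 := by
    have e : ww x0 x1 x2 0 2 0 * x2 = (x1 * x0 * x2) := by
      simp [ww] <;> noncomm_ring
    rw [e]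
    exact (Submodule.mem_sup_left (hw 0 2 1 _ (by simp [ww, mul_assoc]) (by simp [wd])))
  have c0210 : ww x0 x1 x2 0 2 1 * x0 ∈ wsp k x0 x1 x2 (3 + 1) ⊔ V ^ 3 := by
    have e : ww x0 x1 x2 0 2 1 * x0 = -(x0 * x1 * x0 * x2) + (x1 * x0 * (x0 * x1 + x2 * x0 + x1 * x2)) - ((x1 * x0 * x1 - x0 * x1 * x0) * x2) - (x1 * (x0 * x0) * x1) := by
      simp [ww] <;> noncomm_ring
    rw [e]
    exact (sub_mem (sub_mem (add_mem (neg_mem (Submodule.mem_sup_left (hw 1 2 1 _ (by simp [ww, mul_assoc]) (by simp [wd]))))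
      (Submodule.mem_sup_right (ms V (ms V (m1 V h1) h0) hr)))
      (Submodule.mem_sup_right (ms V ht h2)))
      (Submodule.mem_sup_right (ms V (ms V (m1 V h1) hq0) h1)))
  have c0211 : ww x0 x1 x2 0 2 1 * x1 ∈ wsp k x0 x1 x2 (3 + 1) ⊔ V ^ 3 := by
    have e : ww x0 x1 x2 0 2 1 * x1 = (x1 * x0 * (x1 * x0 + x2 * x1 + x0 * x2)) - (x1 * (x0 * x0) * x2) - ((x1 * x0 * x1 - x0 * x1 * x0) * x0) - (x0 * x1 * (x0 * x0)) := by
      simp [ww] <;> noncomm_ring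
    rw [e]
    exact (sub_mem (sub_mem (sub_mem (Submodule.mem_sup_right (ms V (ms V (m1 V h1) h0) hs))
      (Submodule.mem_sup_right (ms V (ms V (m1 V h1) hq0) h2)))
      (Submodule.mem_sup_right (ms V ht h0)))
      (Submodule.mem_sup_right (ms V (ms V (m1 V h0) h1) hq0)))
  have c0212 : ww x0 x1 x2 0 2 1 * x2 ∈ wsp k x0 x1 x2 (3 + 1) ⊔ V ^ 3 := by
    have e : ww x0 x1 x2 0 2 1 * x2 = (x1 * x0 * (x2 * x2)) := by
      simp [ww] <;> noncomm_ring
    rw [e]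
    exact (Submodule.mem_sup_right (ms V (ms V (m1 V h1) h0) hq2))
  have c1000 : ww x0 x1 x2 1 0 0 * x0 ∈ wsp k x0 x1 x2 (1 + 1) ⊔ V ^ 1 := by
    have e : ww x0 x1 x2 1 0 0 * x0 = ((x0 * x0)) := by
      simp [ww] <;> noncomm_ring
    rw [e]
    exact (Submodule.mem_sup_right (m1 V hq0))
  have c1001 : ww x0 x1 x2 1 0 0 * x1 ∈ wsp k x0 x1 x2 (1 + 1) ⊔ V ^ 1 := by
    have e : ww x0 x1 x2 1 0 0 * x1 = (x0 * x1) := by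
      simp [ww] <;> noncomm_ring
    rw [e]
    exact (Submodule.mem_sup_left (hw 1 1 0 _ (by simp [ww, mul_assoc]) (by simp [wd])))
  have c1002 : ww x0 x1 x2 1 0 0 * x2 ∈ wsp k x0 x1 x2 (1 + 1) ⊔ V ^ 1 := by
    have e : ww x0 x1 x2 1 0 0 * x2 = (x0 * x2) := by
      simp [ww] <;> noncomm_ring
    rw [e]
    exact (Submodule.mem_sup_left (hw 1 0 1 _ (by simp [ww, mul_assoc]) (by simp [wd])))
  have c1010 : ww x0 x1 x2 1 0 1 * x0 ∈ wsp k x0 x1 x2 (2 + 1) ⊔ V ^ 2 := by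
    have e : ww x0 x1 x2 1 0 1 * x0 = -(x0 * x1 * x2) + (x0 * (x0 * x1 + x2 * x0 + x1 * x2)) - ((x0 * x0) * x1) := by
      simp [ww] <;> noncomm_ring
    rw [e]
    exact (sub_mem (add_mem (neg_mem (Submodule.mem_sup_left (hw 1 1 1 _ (by simp [ww, mul_assoc]) (by simp [wd]))))
      (Submodule.mem_sup_right (ms V (m1 V h0) hr)))
      (Submodule.mem_sup_right (ms V (m1 V hq0) h1)))
  have c1011 : ww x0 x1 x2 1 0 1 * x1 ∈ wsp k x0 x1 x2 (2 + 1) ⊔ V ^ 2 := by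
    have e : ww x0 x1 x2 1 0 1 * x1 = -(x0 * x1 * x0) + (x0 * (x1 * x0 + x2 * x1 + x0 * x2)) - ((x0 * x0) * x2) := by
      simp [ww] <;> noncomm_ring
    rw [e]
    exact (sub_mem (add_mem (neg_mem (Submodule.mem_sup_left (hw 1 2 0 _ (by simp [ww, mul_assoc]) (by simp [wd]))))
      (Submodule.mem_sup_right (ms V (m1 V h0) hs)))
      (Submodule.mem_sup_right (ms V (m1 V hq0) h2)))
  have c1012 : ww x0 x1 x2 1 0 1 * x2 ∈ wsp k x0 x1 x2 (2 + 1) ⊔ V ^ 2 := by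
    have e : ww x0 x1 x2 1 0 1 * x2 = (x0 * (x2 * x2)) := by
      simp [ww] <;> noncomm_ring
    rw [e]
    exact (Submodule.mem_sup_right (ms V (m1 V h0) hq2))
  have c1100 : ww x0 x1 x2 1 1 0 * x0 ∈ wsp k x0 x1 x2 (2 + 1) ⊔ V ^ 2 := by
    have e : ww x0 x1 x2 1 1 0 * x0 = (x0 * x1 * x0) := by
      simp [ww] <;> noncomm_ring
    rw [e]
    exact (Submodule.mem_sup_left (hw 1 2 0 _ (by simp [ww, mul_assoc]) (by simp [wd])))
  have c1101 : ww x0 x1 x2 1 1 0 * x1 ∈ wsp k x0 x1 x2 (2 + 1) ⊔ V ^ 2 := by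
    have e : ww x0 x1 x2 1 1 0 * x1 = (x0 * (x1 * x1)) := by
      simp [ww] <;> noncomm_ring
    rw [e]
    exact (Submodule.mem_sup_right (ms V (m1 V h0) hq1))
  have c1102 : ww x0 x1 x2 1 1 0 * x2 ∈ wsp k x0 x1 x2 (2 + 1) ⊔ V ^ 2 := by
    have e : ww x0 x1 x2 1 1 0 * x2 = (x0 * x1 * x2) := by
      simp [ww] <;> noncomm_ring
    rw [e]
    exact (Submodule.mem_sup_left (hw 1 1 1 _ (by simp [ww, mul_assoc]) (by simp [wd])))
  have c1110 : ww x0 x1 x2 1 1 1 * x0 ∈ wsp k x0 x1 x2 (3 + 1) ⊔ V ^ 3 := by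
    have e : ww x0 x1 x2 1 1 1 * x0 = (x0 * x1 * (x0 * x1 + x2 * x0 + x1 * x2)) - (x0 * (x1 * x1) * x2) - (x0 * (x1 * x0 * x1 - x0 * x1 * x0)) - ((x0 * x0) * x1 * x0) := by
      simp [ww] <;> noncomm_ring
    rw [e]
    exact (sub_mem (sub_mem (sub_mem (Submodule.mem_sup_right (ms V (ms V (m1 V h0) h1) hr))
      (Submodule.mem_sup_right (ms V (ms V (m1 V h0) hq1) h2)))
      (Submodule.mem_sup_right (mt V (m1 V h0) ht)))
      (Submodule.mem_sup_right (ms V (ms V (m1 V hq0) h1) h0)))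
  have c1111 : ww x0 x1 x2 1 1 1 * x1 ∈ wsp k x0 x1 x2 (3 + 1) ⊔ V ^ 3 := by
    have e : ww x0 x1 x2 1 1 1 * x1 = -(x0 * x1 * x0 * x2) + (x0 * x1 * (x1 * x0 + x2 * x1 + x0 * x2)) - (x0 * (x1 * x1) * x0) := by
      simp [ww] <;> noncomm_ring
    rw [e]
    exact (sub_mem (add_mem (neg_mem (Submodule.mem_sup_left (hw 1 2 1 _ (by simp [ww, mul_assoc]) (by simp [wd]))))
      (Submodule.mem_sup_right (ms V (ms V (m1 V h0) h1) hs)))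
      (Submodule.mem_sup_right (ms V (ms V (m1 V h0) hq1) h0)))
  have c1112 : ww x0 x1 x2 1 1 1 * x2 ∈ wsp k x0 x1 x2 (3 + 1) ⊔ V ^ 3 := by
    have e : ww x0 x1 x2 1 1 1 * x2 = (x0 * x1 * (x2 * x2)) := by
      simp [ww] <;> noncomm_ring
    rw [e]
    exact (Submodule.mem_sup_right (ms V (ms V (m1 V h0) h1) hq2))
  have c1200 : ww x0 x1 x2 1 2 0 * x0 ∈ wsp k x0 x1 x2 (3 + 1) ⊔ V ^ 3 := by
    have e : ww x0 x1 x2 1 2 0 * x0 = (x0 * x1 * (x0 * x0)) := by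
      simp [ww] <;> noncomm_ring
    rw [e]
    exact (Submodule.mem_sup_right (ms V (ms V (m1 V h0) h1) hq0))
  have c1201 : ww x0 x1 x2 1 2 0 * x1 ∈ wsp k x0 x1 x2 (3 + 1) ⊔ V ^ 3 := by
    have e : ww x0 x1 x2 1 2 0 * x1 = (x0 * (x1 * x0 * x1 - x0 * x1 * x0)) + ((x0 * x0) * x1 * x0) := by
      simp [ww] <;> noncomm_ring
    rw [e]
    exact (add_mem (Submodule.mem_sup_right (mt V (m1 V h0) ht))
      (Submodule.mem_sup_right (ms V (ms V (m1 V hq0) h1) h0)))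
  have c1202 : ww x0 x1 x2 1 2 0 * x2 ∈ wsp k x0 x1 x2 (3 + 1) ⊔ V ^ 3 := by
    have e : ww x0 x1 x2 1 2 0 * x2 = (x0 * x1 * x0 * x2) := by
      simp [ww] <;> noncomm_ring
    rw [e]
    exact (Submodule.mem_sup_left (hw 1 2 1 _ (by simp [ww, mul_assoc]) (by simp [wd])))
  have c1210 : ww x0 x1 x2 1 2 1 * x0 ∈ wsp k x0 x1 x2 (4 + 1) ⊔ V ^ 4 := by
    have e : ww x0 x1 x2 1 2 1 * x0 = (x0 * x1 * x0 * (x0 * x1 + x2 * x0 + x1 * x2)) - (x0 * (x1 * x0 * x1 - x0 * x1 * x0) * x2) - ((x0 * x0) * x1 * x0 * x2) - (x0 * x1 * (x0 * x0) * x1) := by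
      simp [ww] <;> noncomm_ring
    rw [e]
    exact (sub_mem (sub_mem (sub_mem (Submodule.mem_sup_right (ms V (ms V (ms V (m1 V h0) h1) h0) hr))
      (Submodule.mem_sup_right (ms V (mt V (m1 V h0) ht) h2)))
      (Submodule.mem_sup_right (ms V (ms V (ms V (m1 V hq0) h1) h0) h2)))
      (Submodule.mem_sup_right (ms V (ms V (ms V (m1 V h0) h1) hq0) h1)))
  have c1211 : ww x0 x1 x2 1 2 1 * x1 ∈ wsp k x0 x1 x2 (4 + 1) ⊔ V ^ 4 := by
    have e : ww x0 x1 x2 1 2 1 * x1 = (x0 * x1 * x0 * (x1 * x0 + x2 * x1 + x0 * x2)) - (x0 * x1 * (x0 * x0) * x2) - (x0 * (x1 * x0 * x1 - x0 * x1 * x0) * x0) - ((x0 * x0) * x1 * x0 * x0) := by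
      simp [ww] <;> noncomm_ring
    rw [e]
    exact (sub_mem (sub_mem (sub_mem (Submodule.mem_sup_right (ms V (ms V (ms V (m1 V h0) h1) h0) hs))
      (Submodule.mem_sup_right (ms V (ms V (ms V (m1 V h0) h1) hq0) h2)))
      (Submodule.mem_sup_right (ms V (mt V (m1 V h0) ht) h0)))
      (Submodule.mem_sup_right (ms V (ms V (ms V (m1 V hq0) h1) h0) h0)))
  have c1212 : ww x0 x1 x2 1 2 1 * x2 ∈ wsp k x0 x1 x2 (4 + 1) ⊔ V ^ 4 := by
    have e : ww x0 x1 x2 1 2 1 * x2 = (x0 * x1 * x0 * (x2 * x2)) := by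
      simp [ww] <;> noncomm_ring
    rw [e]
    exact (Submodule.mem_sup_right (ms V (ms V (ms V (m1 V h0) h1) h0) hq2))
  fin_cases a <;> fin_cases b <;> fin_cases c
  · exact ⟨c0000, c0001, c0002⟩
  · exact ⟨c0010, c0011, c0012⟩
  · exact ⟨c0100, c0101, c0102⟩
  · exact ⟨c0110, c0111, c0112⟩
  · exact ⟨c0200, c0201, c0202⟩
  · exact ⟨c0210, c0211, c0212⟩
  · exact ⟨c1000, c1001, c1002⟩
  · exact ⟨c1010, c1011, c1012⟩
  · exact ⟨c1100, c1101, c1102⟩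
  · exact ⟨c1110, c1111, c1112⟩
  · exact ⟨c1200, c1201, c1202⟩
  · exact ⟨c1210, c1211, c1212⟩

end Span

end FKL


namespace FKL

theorem zcases (P : ZMod 3 → Prop) (h : P 0 ∧ P 1 ∧ P 2) (i : ZMod 3) : P i := by
  obtain ⟨h0, h1, h2⟩ := h
  fin_cases i
  · exact h0
  · exact h1
  · exact h2

theorem span_top {k : Type*} [Field k] {A : Type*} [Ring A] [Algebra k A] {G : Type*} [Group G]
    (X : G → A) (x : ZMod 3 → A) (g : ZMod 3 → G) (ρ : G → ZMod 3 → ZMod 3) (b : G → ZMod 3 → k)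
    (hXX : ∀ a c, X a * X c = X (a * c)) (hX1 : X 1 = 1)
    (hXx : ∀ a i, X a * x i = (x (ρ a i) + b a i • (1 + X (g (ρ a i)))) * X a)
    (V : Submodule k A)
    (hV : V = Submodule.span k (Set.range X ∪ Set.range (fun p : ZMod 3 × G => x p.1 * X p.2)))
    (hq : ∀ i, x i * x i ∈ V)
    (hr : x 0 * x 1 + x 2 * x 0 + x 1 * x 2 ∈ V) (hs : x 1 * x 0 + x 2 * x 1 + x 0 * x 2 ∈ V)
    (hadj : Algebra.adjoin k (Set.range X ∪ Set.range x) = ⊤) :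
    Submodule.span k (Set.range (fun p : G × Fin 2 × Fin 3 × Fin 2 =>
      ww (x 0) (x 1) (x 2) p.2.1 p.2.2.1 p.2.2.2 * X p.1)) = ⊤ := by
  have hXV : ∀ a, X a ∈ V := fun a => by
    rw [hV]; exact Submodule.subset_span (Or.inl ⟨a, rfl⟩)
  have hxXV : ∀ i a, x i * X a ∈ V := fun i a => by
    rw [hV]; exact Submodule.subset_span (Or.inr ⟨(i, a), rfl⟩)
  have hxV : ∀ i, x i ∈ V := fun i => by simpa [hX1] using hxXV i 1
  have h1V : (1 : A) ∈ V := hX1 ▸ hXV 1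
  have hmono : ∀ m n : ℕ, m ≤ n → V ^ m ≤ V ^ n := fun m n h =>
    pow_le_pow_right₀ (by rw [Submodule.one_le]; exact h1V) h
  have hred := red_all V (x 0) (x 1) (x 2) (hxV 0) (hxV 1) (hxV 2) (hq 0) (hq 1) (hq 2) hr hs
  have hred' : ∀ j a b c, ww (x 0) (x 1) (x 2) a b c * x j ∈
      wsp k (x 0) (x 1) (x 2) (wd a b c + 1) ⊔ V ^ wd a b c := by
    intro j a b c
    revert j
    exact zcases _ (hred a b c)
  let S : ℕ → Submodule k A := fun n =>
    Submodule.span k {y | ∃ a b c h, wd a b c ≤ n ∧ ww (x 0) (x 1) (x 2) a b c * X h = y}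
  have hSX : ∀ n h y, y ∈ S n → y * X h ∈ S n := by
    intro n h y hy
    induction hy using Submodule.span_induction with
    | mem y hy =>
      obtain ⟨a, b, c, h', hd, rfl⟩ := hy
      exact Submodule.subset_span ⟨a, b, c, h' * h, hd, by rw [mul_assoc, hXX]⟩
    | zero => simp
    | add y z _ _ h1 h2 => rw [add_mul]; exact add_mem h1 h2
    | smul r y _ h1 => rw [smul_mul_assoc]; exact Submodule.smul_mem _ _ h1
  have hSm : ∀ m n, m ≤ n → S m ≤ S n := by
    intro m n hmn
    apply Submodule.span_mono
    rintro y ⟨a, b, c, h, hd, e⟩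
    exact ⟨a, b, c, h, hd.trans hmn, e⟩
  have hwS : ∀ n, wsp k (x 0) (x 1) (x 2) n ≤ S n := by
    intro n
    apply Submodule.span_mono
    rintro y ⟨a, b, c, hd, e⟩
    exact ⟨a, b, c, 1, hd, by rw [hX1, mul_one, e]⟩
  have hVS : ∀ n, V ^ n ≤ S n := by
    intro n
    induction n with
    | zero =>
      rw [pow_zero, Submodule.one_le]
      exact Submodule.subset_span ⟨0, 0, 0, 1, by simp [wd], by simp [ww, hX1]⟩
    | succ n ih =>
      have hstep : ∀ a b c, wd a b c ≤ n → ∀ j h, ww (x 0) (x 1) (x 2) a b c * x j * X h ∈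
          S (n + 1) := by
        intro a b c hd j h
        apply hSX
        have h1 : wsp k (x 0) (x 1) (x 2) (wd a b c + 1) ⊔ V ^ wd a b c ≤ S (n + 1) :=
          sup_le ((hwS _).trans (hSm _ _ (by omega)))
            ((hmono _ n hd).trans (ih.trans (hSm _ _ (by omega))))
        exact h1 (hred' j a b c)
      rw [pow_succ]
      refine (mul_le_mul' ih le_rfl).trans ?_
      show Submodule.span k _ * V ≤ _
      rw [hV, Submodule.span_mul_span, Submodule.span_le]
      rintro _ ⟨_, ⟨a, b', c, h, hd, rfl⟩, _, ⟨h', rfl⟩ | ⟨⟨i, h'⟩, rfl⟩, rfl⟩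
      · apply hSX
        exact hSm _ _ (Nat.le_succ n) (Submodule.subset_span ⟨a, b', c, h, hd, rfl⟩)
      · have e : ww (x 0) (x 1) (x 2) a b' c * X h * (x i * X h') =
            ww (x 0) (x 1) (x 2) a b' c * x (ρ h i) * X (h * h')
            + b h i • (ww (x 0) (x 1) (x 2) a b' c * X (h * h')
              + ww (x 0) (x 1) (x 2) a b' c * X (g (ρ h i) * (h * h'))) := by
          rw [mul_assoc, ← mul_assoc (X h), hXx, ← hXX h h', ← hXX (g _)  (h * h'), ← hXX h h']
          simp only [mul_add, add_mul, smul_mul_assoc, mul_smul_comm, smul_add, one_mul, mul_assoc]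
        show ww (x 0) (x 1) (x 2) a b' c * X h * (x i * X h') ∈ _
        rw [e]
        refine add_mem (hstep a b' c hd _ _) (Submodule.smul_mem _ _ (add_mem ?_ ?_)) <;>
          exact Submodule.subset_span ⟨a, b', c, _, by omega, rfl⟩
  have hall : ∀ y : A, ∃ n, y ∈ V ^ n := by
    intro y
    have hy : y ∈ Algebra.adjoin k (Set.range X ∪ Set.range x) := by rw [hadj]; trivial
    induction hy using Algebra.adjoin_induction with
    | mem y hy =>
      rcases hy with ⟨a, rfl⟩ | ⟨i, rfl⟩
      · exact ⟨1, m1 V (hXV a)⟩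
      · exact ⟨1, m1 V (hxV i)⟩
    | algebraMap r => exact ⟨0, by rw [pow_zero]; exact Submodule.algebraMap_mem r⟩
    | add y z _ _ h1 h2 =>
      obtain ⟨m, hm⟩ := h1
      obtain ⟨n, hn⟩ := h2
      exact ⟨max m n, add_mem (hmono _ _ (le_max_left _ _) hm) (hmono _ _ (le_max_right _ _) hn)⟩
    | mul y z _ _ h1 h2 =>
      obtain ⟨m, hm⟩ := h1
      obtain ⟨n, hn⟩ := h2
      exact ⟨m + n, by rw [pow_add]; exact Submodule.mul_mem_mul hm hn⟩
  rw [eq_top_iff]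
  intro y _
  obtain ⟨n, hn⟩ := hall y
  refine Submodule.span_mono ?_ (hVS n hn)
  rintro z ⟨a, b, c, h, _, rfl⟩
  exact ⟨(h, a, b, c), rfl⟩

end FKL


namespace FKL

theorem rack_symm : ∀ i j : ZMod 3, rackOp i j = rackOp j i := by decide
theorem rack_c1 : ∀ i j : ZMod 3, rackOp (rackOp i j) i = j := by decide
theorem rack_c2 : ∀ i j : ZMod 3, rackOp j (rackOp i j) = i := by decide
theorem rack_inv : ∀ i j : ZMod 3, rackOp i (rackOp i j) = j := by decide

theorem two_smul_zero {k : Type*} [Field k] [CharP k 2] {B : Type*} [Ring B] [Algebra k B]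
    (v : B) : v + v = 0 := by
  have h : (2 : k) = 0 := CharTwo.two_eq_zero
  have : (2 : k) • v = 0 := by rw [h, zero_smul]
  rwa [two_smul] at this

theorem rep_exists {k : Type*} [Field k] [CharP k 2] {G : Type*} [Group G]
    (g : ZMod 3 → G) (hg : ∀ i j : ZMod 3, g i * g j = g (rackOp i j) * g i)
    (ρ : G →* Equiv.Perm (ZMod 3)) (hρ : ∀ i j : ZMod 3, ρ (g i) j = rackOp i j)
    (hconj : ∀ (a : G) (i : ZMod 3), a * g i * a⁻¹ = g (ρ a i))
    (b : G → ZMod 3 → k) (μ : ZMod 3 → ZMod 3 → k)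
    (hmij : ∀ i j : ZMod 3, μ i j = μ (rackOp i j) i ∧ μ i j = μ j (rackOp i j))
    {B : Type*} [Ring B] [Algebra k B] (a : ZMod 3 → B) (H D : G → B)
    (hH : ∀ u v, H (u * v) = H u * H v) (hD : ∀ u v, D (u * v) = D v * D u)
    (hH1 : H 1 = 1) (hD1 : D 1 = 1)
    (hHa : ∀ u i, H u * a i = (a (ρ u i) + b u i • 1) * H u)
    (haD : ∀ u i, a i * D u = D u * (a (ρ u i) + b u i • 1))
    (ha : ∀ i j, a i * a j + a (rackOp i j) * a i + a j * a (rackOp i j) + b (g i) j • a i +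
      b (g (rackOp i j)) i • a (rackOp i j) + b (g j) (rackOp i j) • a j + μ i j • 1 = 0) :
    ∃ Φ : RingQuot (LRel k g ρ b μ) →ₐ[k] Module.End k B,
      (∀ h v, Φ (RingQuot.mkAlgHom k (LRel k g ρ b μ) (FreeAlgebra.ι k (Sum.inl h))) v =
        H h * v * D h) ∧
      (∀ i v, Φ (RingQuot.mkAlgHom k (LRel k g ρ b μ) (FreeAlgebra.ι k (Sum.inr i))) v =
        a i * v + H (g i) * v * (a i * D (g i))) := by
  let f : G ⊕ ZMod 3 → Module.End k B := Sum.elim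
    (fun h => LinearMap.mulLeft k (H h) * LinearMap.mulRight k (D h))
    (fun i => LinearMap.mulLeft k (a i) +
      LinearMap.mulLeft k (H (g i)) * LinearMap.mulRight k (a i * D (g i)))
  have f1 : ∀ h v, f (Sum.inl h) v = H h * v * D h := by
    intro h v; simp [f, mul_assoc]
  have f2 : ∀ i v, f (Sum.inr i) v = a i * v + H (g i) * v * (a i * D (g i)) := by
    intro h v; simp [f, mul_assoc]
  have hf : ∀ ⦃u v⦄, LRel k g ρ b μ u v → FreeAlgebra.lift k f u = FreeAlgebra.lift k f v := by
    rintro u v (⟨p, q, rfl, rfl⟩ | ⟨rfl, rfl⟩ | ⟨p, i, rfl, rfl⟩ | ⟨i, j, rfl, rfl⟩)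
    · refine LinearMap.ext fun w => ?_
      simp only [map_mul, FreeAlgebra.lift_ι_apply, Module.End.mul_apply, f1, hH, hD, mul_assoc]
    · refine LinearMap.ext fun w => ?_
      simp [FreeAlgebra.lift_ι_apply, f1, hH1, hD1]
    · refine LinearMap.ext fun w => ?_
      have hc : p * g i = g (ρ p i) * p := by rw [← hconj]; group
      simp only [map_mul, map_add, map_smul, map_one, FreeAlgebra.lift_ι_apply,
        Module.End.mul_apply, LinearMap.add_apply, LinearMap.smul_apply, Module.End.one_apply,
        f1, f2]
      have e1 : H p * (a i * w) * D p = (a (ρ p i) + b p i • 1) * (H p * w * D p) := by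
        rw [← mul_assoc, hHa]; simp only [mul_assoc]
      have e2 : H p * (H (g i) * w * (a i * D (g i))) * D p =
          H (g (ρ p i)) * (H p * w * D p) * ((a (ρ p i) + b p i • 1) * D (g (ρ p i))) := by
        have : a i * D (g i) * D p = D p * (a (ρ p i) + b p i • 1) * D (g (ρ p i)) := by
          rw [mul_assoc, ← hD, hc, hD, ← mul_assoc, haD]
        calc _ = (H p * H (g i)) * w * (a i * D (g i) * D p) := by simp only [mul_assoc]
          _ = _ := by
            rw [this, ← hH, hc, hH]; simp only [mul_assoc]
      rw [mul_add, add_mul, e1, e2]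
      simp only [add_mul, mul_add, smul_add, smul_mul_assoc, mul_smul_comm, one_mul, mul_assoc]
      abel
    · refine LinearMap.ext fun w => ?_
      simp only [map_mul, map_add, map_smul, map_one, FreeAlgebra.lift_ι_apply, map_zero,
        Module.End.mul_apply, LinearMap.add_apply, LinearMap.smul_apply, Module.End.one_apply,
        f1, f2, LinearMap.zero_apply]
      set l := rackOp i j with hl
      have key : ∀ i j, a i * (a j * w + H (g j) * w * (a j * D (g j))) +
          H (g i) * (a j * w + H (g j) * w * (a j * D (g j))) * (a i * D (g i)) =
          a i * a j * w + a i * (H (g j) * w * (a j * D (g j))) +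
          a (rackOp i j) * (H (g i) * w * (a i * D (g i))) +
          b (g i) j • (H (g i) * w * (a i * D (g i))) +
          H (g i * g j) * w * ((a j * a (rackOp i j) + b (g j) (rackOp i j) • a j) *
            D (g i * g j)) := by
        intro i j
        have e1 : H (g i) * (a j * w) * (a i * D (g i)) =
          a (rackOp i j) * (H (g i) * w * (a i * D (g i))) +
          b (g i) j • (H (g i) * w * (a i * D (g i))) := by
          rw [← mul_assoc (H (g i)), hHa, hρ]
          simp only [add_mul, smul_mul_assoc, one_mul, mul_assoc]
        have e2 : D (g j) * a i = (a (rackOp i j) + b (g j) (rackOp i j) • 1) * D (g j) := by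
          have := haD (g j) (rackOp i j)
          rw [hρ, rack_c2] at this
          have h' : D (g j) * a i = a (rackOp i j) * D (g j) - b (g j) (rackOp i j) • D (g j) := by
            rw [this, mul_add]; simp
          rw [h', sub_eq_add_neg, add_mul, smul_mul_assoc, one_mul, ← neg_smul]
          congr 2
          exact CharTwo.neg_eq _
        have e3 : H (g i) * (H (g j) * w * (a j * D (g j))) * (a i * D (g i)) =
          H (g i * g j) * w * ((a j * a (rackOp i j) + b (g j) (rackOp i j) • a j) *
            D (g i * g j)) := by
          calc _ = H (g i) * H (g j) * w * (a j * (D (g j) * a i) * D (g i)) := by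
                simp only [mul_assoc]
            _ = _ := by
                rw [e2, ← hH, hD]
                simp only [mul_add, add_mul, smul_mul_assoc, mul_smul_comm, one_mul, mul_assoc]
        rw [mul_add, mul_add, add_mul, e1, e3]
        simp only [mul_assoc]
        abel
      rw [key i j, key l i, key j l]
      have r1 : rackOp l i = j := rack_c1 i j
      have r2 : rackOp j l = i := rack_c2 i j
      have g1 : g l * g i = g i * g j := (hg i j).symm
      have g2 : g j * g l = g i * g j := by rw [hg j l, r2]
      rw [r1, r2, g1, g2]
      have q1 := ha i j
      have q2 := ha j l
      rw [← hl] at q1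
      rw [r2, ← (hmij i j).2] at q2
      have z1 : (a i * a j + a l * a i + a j * a l + b (g i) j • a i +
        b (g l) i • a l + b (g j) l • a j + μ i j • 1) * w = 0 := by rw [q1, zero_mul]
      have z2 : H (g i * g j) * w * ((a j * a l + a i * a j + a l * a i + b (g j) l • a j +
        b (g i) j • a i + b (g l) i • a l + μ i j • 1) * D (g i * g j)) = 0 := by
        rw [q2, zero_mul, mul_zero]
      have t := fun v : B => two_smul_zero (k := k) v
      have z3 := t (a i * (H (g j) * w * (a j * D (g j))))
      have z4 := t (a l * (H (g i) * w * (a i * D (g i))))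
      have z5 := t (a j * (H (g l) * w * (a l * D (g l))))
      have z6 := t (b (g i) j • (H (g i) * w * (a i * D (g i))))
      have z7 := t (b (g l) i • (H (g l) * w * (a l * D (g l))))
      have z8 := t (b (g j) l • (H (g j) * w * (a j * D (g j))))
      have tot := congrArg₂ (· + ·) (congrArg₂ (· + ·) (congrArg₂ (· + ·) z1 z2)
        (congrArg₂ (· + ·) z3 z4)) (congrArg₂ (· + ·) (congrArg₂ (· + ·) z5 z6)
          (congrArg₂ (· + ·) z7 z8))
      simp only [add_zero] at tot
      rw [← tot]
      simp only [add_mul, mul_add, smul_add, smul_mul_assoc, mul_smul_comm, one_mul, mul_one,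
        mul_assoc]
      abel
  refine ⟨RingQuot.liftAlgHom k ⟨FreeAlgebra.lift k f, hf⟩, ?_, ?_⟩
  · intro h v
    rw [RingQuot.liftAlgHom_mkAlgHom_apply, FreeAlgebra.lift_ι_apply, f1]
  · intro h v
    rw [RingQuot.liftAlgHom_mkAlgHom_apply, FreeAlgebra.lift_ι_apply, f2]

end FKL


namespace FKL

/-- Relations of the normalised 12-dimensional algebra. -/
def ERel (k : Type*) [Field k] (c m n : k) (u v : FreeAlgebra k (ZMod 3)) : Prop :=
  ∃ i j : ZMod 3, u = FreeAlgebra.ι k i * FreeAlgebra.ι k j +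
      FreeAlgebra.ι k (rackOp i j) * FreeAlgebra.ι k i +
      FreeAlgebra.ι k j * FreeAlgebra.ι k (rackOp i j) +
      c • (FreeAlgebra.ι k i + FreeAlgebra.ι k j + FreeAlgebra.ι k (rackOp i j)) +
      (if i = j then m else n) • 1 ∧ v = 0

/-- The normalised algebra. -/
abbrev EA (k : Type*) [Field k] (c m n : k) := RingQuot (ERel k c m n)

/-- Its generators. -/
noncomputable def Y (k : Type*) [Field k] (c m n : k) (i : ZMod 3) : EA k c m n :=
  RingQuot.mkAlgHom k (ERel k c m n) (FreeAlgebra.ι k i)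

section
variable {k : Type*} [Field k] {c m n : k}

theorem Y_rel (i j : ZMod 3) : Y k c m n i * Y k c m n j + Y k c m n (rackOp i j) * Y k c m n i +
    Y k c m n j * Y k c m n (rackOp i j) +
    c • (Y k c m n i + Y k c m n j + Y k c m n (rackOp i j)) + (if i = j then m else n) • 1 = 0 := by
  have := RingQuot.mkAlgHom_rel k (s := ERel k c m n) ⟨i, j, rfl, rfl⟩
  simp only [map_add, map_mul, map_smul, map_one, map_zero] at this
  exact this

theorem E_lift {B : Type*} [Ring B] [Algebra k B] (y : ZMod 3 → B)
    (hy : ∀ i j, y i * y j + y (rackOp i j) * y i + y j * y (rackOp i j) +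
      c • (y i + y j + y (rackOp i j)) + (if i = j then m else n) • 1 = 0) :
    ∃ φ : EA k c m n →ₐ[k] B, ∀ i, φ (Y k c m n i) = y i := by
  refine ⟨RingQuot.liftAlgHom k ⟨FreeAlgebra.lift k y, ?_⟩, ?_⟩
  · rintro u v ⟨i, j, rfl, rfl⟩
    simpa only [map_add, map_mul, map_smul, map_one, map_zero, FreeAlgebra.lift_ι_apply] using hy i j
  · intro i
    rw [Y, RingQuot.liftAlgHom_mkAlgHom_apply, FreeAlgebra.lift_ι_apply]

theorem E_ext {B : Type*} [Ring B] [Algebra k B] (φ ψ : EA k c m n →ₐ[k] B)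
    (h : ∀ i, φ (Y k c m n i) = ψ (Y k c m n i)) : φ = ψ := by
  apply RingQuot.ringQuot_ext'
  apply FreeAlgebra.hom_ext
  funext i
  exact h i

theorem perm_rack : ∀ (σ : Equiv.Perm (ZMod 3)) (i j : ZMod 3),
    rackOp (σ i) (σ j) = σ (rackOp i j) := by decide

theorem al_exists [CharP k 2] (σ : Equiv.Perm (ZMod 3)) (β : k) (hβ : β * β + c * β = 0) :
    ∃ φ : EA k c m n →ₐ[k] EA k c m n, ∀ i, φ (Y k c m n i) = Y k c m n (σ i) + β • 1 := by
  apply E_lift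
  intro i j
  have h := Y_rel (k := k) (c := c) (m := m) (n := n) (σ i) (σ j)
  rw [perm_rack] at h
  simp only [EmbeddingLike.apply_eq_iff_eq] at h
  have t := fun v : EA k c m n => two_smul_zero (k := k) v
  have z1 := t (β • Y k c m n (σ i))
  have z2 := t (β • Y k c m n (σ j))
  have z3 := t (β • Y k c m n (σ (rackOp i j)))
  have z4 : (β * β + c * β) • (1 : EA k c m n) = 0 := by rw [hβ, zero_smul]
  have tot := congrArg₂ (· + ·) (congrArg₂ (· + ·) h z1) (congrArg₂ (· + ·)
    (congrArg₂ (· + ·) z2 z3) (congrArg₂ (· + ·) (congrArg₂ (· + ·) z4 z4) z4))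
  simp only [add_zero] at tot
  rw [← tot]
  simp only [add_mul, mul_add, smul_add, smul_mul_assoc, mul_smul_comm, one_mul, mul_one,
    add_smul, mul_smul]
  abel

/-- The generators acting on the 12-dimensional module. -/
def Mz (c m n : k) (i : ZMod 3) : Module.End k (Fin 12 → k) :=
  if i = 0 then M0 c m n else if i = 1 then M1 c m n else M2 c m n

theorem Mz0 : Mz c m n 0 = M0 c m n := rfl
theorem Mz1 : Mz c m n 1 = M1 c m n := rfl
theorem Mz2 : Mz c m n 2 = M2 c m n := rfl

theorem Mz_rel [CharP k 2] (i j : ZMod 3) : Mz c m n i * Mz c m n j +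
    Mz c m n (rackOp i j) * Mz c m n i + Mz c m n j * Mz c m n (rackOp i j) +
    c • (Mz c m n i + Mz c m n j + Mz c m n (rackOp i j)) + (if i = j then m else n) • 1 = 0 := by
  have t := fun v : Module.End k (Fin 12 → k) => two_smul_zero (k := k) v
  have dbl : ∀ M : Module.End k (Fin 12 → k), M * M + c • M + m • 1 = 0 →
      M * M + M * M + M * M + c • (M + M + M) + m • 1 = 0 := by
    intro M h
    have z1 := t (M * M)
    have z2 := t (c • M)
    have tot := congrArg₂ (· + ·) h (congrArg₂ (· + ·) z1 z2)
    simp only [add_zero] at tot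
    rw [← tot]
    simp only [smul_add]
    abel
  have h01 := M_01 c m n
  have h10 := M_10 c m n
  have q0 := dbl _ (M0_sq c m n)
  have q1 := dbl _ (M1_sq c m n)
  have q2 := dbl _ (M2_sq c m n)
  revert i j
  refine zcases _ ⟨zcases _ ⟨?_, ?_, ?_⟩, zcases _ ⟨?_, ?_, ?_⟩, zcases _ ⟨?_, ?_, ?_⟩⟩
  · exact q0
  · rw [← h01]
    change M0 c m n * M1 c m n + M2 c m n * M0 c m n + M1 c m n * M2 c m n +
      c • (M0 c m n + M1 c m n + M2 c m n) + n • 1 = _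
    abel
  · rw [← h10]
    change M0 c m n * M2 c m n + M1 c m n * M0 c m n + M2 c m n * M1 c m n +
      c • (M0 c m n + M2 c m n + M1 c m n) + n • 1 = _
    simp only [smul_add]
    abel
  · rw [← h10]
    change M1 c m n * M0 c m n + M2 c m n * M1 c m n + M0 c m n * M2 c m n +
      c • (M1 c m n + M0 c m n + M2 c m n) + n • 1 = _
    simp only [smul_add]
    abel
  · exact q1
  · rw [← h01]
    change M1 c m n * M2 c m n + M0 c m n * M1 c m n + M2 c m n * M0 c m n +
      c • (M1 c m n + M2 c m n + M0 c m n) + n • 1 = _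
    simp only [smul_add]
    abel
  · rw [← h01]
    change M2 c m n * M0 c m n + M1 c m n * M2 c m n + M0 c m n * M1 c m n +
      c • (M2 c m n + M0 c m n + M1 c m n) + n • 1 = _
    simp only [smul_add]
    abel
  · rw [← h10]
    change M2 c m n * M1 c m n + M0 c m n * M2 c m n + M1 c m n * M0 c m n +
      c • (M2 c m n + M1 c m n + M0 c m n) + n • 1 = _
    simp only [smul_add]
    abel
  · exact q2

/-- Position of a normal monomial in the list of twelve. -/
def idx (a : Fin 2) (b : Fin 3) (c : Fin 2) : Fin 12 :=
  ⟨6 * a.val + 2 * b.val + c.val, by omega⟩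

theorem idx_inj : ∀ a b c a' b' c', idx a b c = idx a' b' c' → a = a' ∧ b = b' ∧ c = c' := by
  decide

theorem dg_idx : ∀ a b c, dg (idx a b c) = wd a b c := by decide

/-- The filtration on the normalised algebra. -/
noncomputable def VE (k : Type*) [Field k] (c m n : k) : Submodule k (EA k c m n) :=
  Submodule.span k (insert 1 (Set.range (Y k c m n)))

theorem M2_e0 : M2 c m n (Pi.single 0 1) = Pi.single 1 1 := by
  funext j
  fin_cases j <;> simp [M2, F2, Pi.single_apply]

theorem M1_e0 : M1 c m n (Pi.single 0 1) = Pi.single 2 1 := by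
  funext j
  fin_cases j <;> simp [M1, F1, Pi.single_apply]

theorem M1_e1 : M1 c m n (Pi.single 1 1) = Pi.single 3 1 := by
  funext j
  fin_cases j <;> simp [M1, F1, Pi.single_apply]

theorem M1_e6 : M1 c m n (Pi.single 6 1) = Pi.single 4 1 := by
  funext j
  fin_cases j <;> simp [M1, F1, Pi.single_apply]

theorem M1_e7 : M1 c m n (Pi.single 7 1) = Pi.single 5 1 := by
  funext j
  fin_cases j <;> simp [M1, F1, Pi.single_apply]

theorem M0_e0 : M0 c m n (Pi.single 0 1) = Pi.single 6 1 := by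
  funext j
  fin_cases j <;> simp [M0, F0, Pi.single_apply]

theorem M0_e1 : M0 c m n (Pi.single 1 1) = Pi.single 7 1 := by
  funext j
  fin_cases j <;> simp [M0, F0, Pi.single_apply]

theorem M0_e2 : M0 c m n (Pi.single 2 1) = Pi.single 8 1 := by
  funext j
  fin_cases j <;> simp [M0, F0, Pi.single_apply]

theorem M0_e3 : M0 c m n (Pi.single 3 1) = Pi.single 9 1 := by
  funext j
  fin_cases j <;> simp [M0, F0, Pi.single_apply]

theorem M0_e4 : M0 c m n (Pi.single 4 1) = Pi.single 10 1 := by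
  funext j
  fin_cases j <;> simp [M0, F0, Pi.single_apply]

theorem M0_e5 : M0 c m n (Pi.single 5 1) = Pi.single 11 1 := by
  funext j
  fin_cases j <;> simp [M0, F0, Pi.single_apply]

theorem pi_exists [CharP k 2] : ∃ π : EA k c m n →ₗ[k] (Fin 12 → k),
    (∀ a b c', π (ww (Y k c m n 0) (Y k c m n 1) (Y k c m n 2) a b c') =
      Pi.single (idx a b c') 1) ∧
    ∀ d, ∀ e ∈ VE k c m n ^ d, ∀ j, d < dg j → π e j = 0 := by
  obtain ⟨ψ, hψ⟩ := E_lift (Mz c m n) (Mz_rel (k := k) (c := c) (m := m) (n := n))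
  refine ⟨(LinearMap.applyₗ (Pi.single 0 1 : Fin 12 → k)) ∘ₗ ψ.toLinearMap, ?_, ?_⟩
  · intro a b c'
    fin_cases a <;> fin_cases b <;> fin_cases c' <;>
      simp [ww, hψ, Mz0, Mz1, Mz2, idx, M2_e0, M1_e0, M1_e1, M1_e6, M1_e7, M0_e0, M0_e1, M0_e2,
        M0_e3, M0_e4, M0_e5]
  · intro d e he
    change ∀ j, d < dg j → ψ e (Pi.single 0 1) j = 0
    induction d generalizing e with
    | zero =>
      rw [pow_zero, Submodule.mem_one] at he
      obtain ⟨r, rfl⟩ := he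
      intro j hj
      rw [AlgHom.commutes, Module.algebraMap_end_apply]
      have : j ≠ 0 := by
        rintro rfl
        exact absurd hj (by decide)
      simp [this]
    | succ d ih =>
      rw [pow_succ'] at he
      induction he using Submodule.mul_induction_on' with
      | add x hx y hy h1 h2 =>
        intro j hj
        rw [map_add, LinearMap.add_apply, Pi.add_apply, h1 j hj, h2 j hj, add_zero]
      | mem_mul_mem u hu e he =>
        have ih' := ih e he
        intro j hj
        rw [map_mul, Module.End.mul_apply]
        have hd := M_deg c m n (d + 1) (ψ e (Pi.single 0 1)) (fun j hj => ih' j (by omega)) j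
          (by omega)
        unfold VE at hu
        induction hu using Submodule.span_induction with
        | mem u hu =>
          rcases hu with rfl | ⟨i, rfl⟩
          · rw [map_one, Module.End.one_apply]
            exact ih' j (by omega)
          · rw [hψ]
            revert i
            exact zcases _ ⟨hd.1, hd.2.1, hd.2.2⟩
        | zero => simp
        | add x y hx hy h1 h2 =>
          rw [map_add, LinearMap.add_apply, Pi.add_apply, h1, h2, add_zero]
        | smul r x hx h1 =>
          rw [map_smul, LinearMap.smul_apply, Pi.smul_apply, h1, smul_zero]
end
end FKL


namespace FKL

theorem lam_form {k : Type*} [Field k] [CharP k 2] (l : ZMod 3 → ZMod 3 → k)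
    (h : ∀ i j t, l i (rackOp j t) + l j t = l (rackOp i j) (rackOp i t) + l i t) :
    ∃ (c : k) (cc : ZMod 3 → k), ∀ i j, l i j = c + cc j + cc (rackOp i j) := by
  have h2 : (2 : k) = 0 := CharTwo.two_eq_zero
  refine ⟨l 0 0, ![0, l 2 0 + l 0 0, l 1 0 + l 0 0], ?_⟩
  have hh : ∀ i j t, ∀ p q r : ZMod 3, rackOp j t = p → rackOp i j = q → rackOp i t = r →
      l i p + l j t = l q r + l i t := by
    rintro i j t p q r rfl rfl rfl
    exact h i j t
  have a1 := hh 0 1 0 2 2 0 rfl rfl rfl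
  have a2 := hh 0 1 1 1 2 2 rfl rfl rfl
  have a3 := hh 0 1 2 0 2 1 rfl rfl rfl
  have a4 := hh 0 2 0 1 1 0 rfl rfl rfl
  have a5 := hh 0 2 1 0 1 2 rfl rfl rfl
  have a6 := hh 0 2 2 2 1 1 rfl rfl rfl
  have a7 := hh 1 0 0 0 2 2 rfl rfl rfl
  have a8 := hh 1 0 1 2 2 1 rfl rfl rfl
  have a9 := hh 1 0 2 1 2 0 rfl rfl rfl
  have a10 := hh 1 2 0 1 0 2 rfl rfl rfl
  have a11 := hh 1 2 1 0 0 1 rfl rfl rfl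
  have a12 := hh 1 2 2 2 0 0 rfl rfl rfl
  have a13 := hh 2 0 0 0 1 1 rfl rfl rfl
  have a14 := hh 2 0 1 2 1 0 rfl rfl rfl
  have a15 := hh 2 0 2 1 1 2 rfl rfl rfl
  clear h hh
  refine zcases _ ⟨zcases _ ⟨?_, ?_, ?_⟩, zcases _ ⟨?_, ?_, ?_⟩, zcases _ ⟨?_, ?_, ?_⟩⟩
  · change l 0 0 = l 0 0 + 0 + 0
    grind
  · change l 0 1 = l 0 0 + (l 2 0 + l 0 0) + (l 1 0 + l 0 0)
    grind
  · change l 0 2 = l 0 0 + (l 1 0 + l 0 0) + (l 2 0 + l 0 0)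
    grind
  · change l 1 0 = l 0 0 + 0 + (l 1 0 + l 0 0)
    grind
  · change l 1 1 = l 0 0 + (l 2 0 + l 0 0) + (l 2 0 + l 0 0)
    grind
  · change l 1 2 = l 0 0 + (l 1 0 + l 0 0) + 0
    grind
  · change l 2 0 = l 0 0 + 0 + (l 2 0 + l 0 0)
    grind
  · change l 2 1 = l 0 0 + (l 2 0 + l 0 0) + 0
    grind
  · change l 2 2 = l 0 0 + (l 1 0 + l 0 0) + (l 1 0 + l 0 0)
    grind

theorem mu_form {k : Type*} [Field k] [CharP k 2] (l μ : ZMod 3 → ZMod 3 → k) (c : k)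
    (cc : ZMod 3 → k) (hl : ∀ i j, l i j = c + cc j + cc (rackOp i j))
    (hmij : ∀ i j : ZMod 3, μ i j = μ (rackOp i j) i ∧ μ i j = μ j (rackOp i j))
    (hrel : ∀ i j t : ZMod 3,
      μ i j + μ (rackOp t i) (rackOp t j) =
        l t i * (l t (rackOp i j) + l i j) +
        l t j * (l t i + l j (rackOp i j)) +
        l t (rackOp i j) * (l t j + l (rackOp i j) i)) :
    ∃ m n : k, ∀ i j, cc i * cc j + cc (rackOp i j) * cc i + cc j * cc (rackOp i j) +
      l i j * cc i + l (rackOp i j) i * cc (rackOp i j) + l j (rackOp i j) * cc j + μ i j =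
      if i = j then m else n := by
  have h2 : (2 : k) = 0 := CharTwo.two_eq_zero
  refine ⟨cc 0 * cc 0 + c * cc 0 + μ 0 0, cc 0 * cc 1 + cc 2 * cc 0 + cc 1 * cc 2 +
      l 0 1 * cc 0 + l 2 0 * cc 2 + l 1 2 * cc 1 + μ 0 1, ?_⟩
  have hh : ∀ i j t, ∀ p q r : ZMod 3, rackOp i j = p → rackOp t i = q → rackOp t j = r →
      μ i j + μ q r = l t i * (l t p + l i j) + l t j * (l t i + l j p) +
        l t p * (l t j + l p i) := by
    rintro i j t p q r rfl rfl rfl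
    exact hrel i j t
  have hl' : ∀ i j p, rackOp i j = p → l i j = c + cc j + cc p := by
    rintro i j p rfl
    exact hl i j
  have l00 := hl' 0 0 0 rfl
  have l01 := hl' 0 1 2 rfl
  have l02 := hl' 0 2 1 rfl
  have l10 := hl' 1 0 2 rfl
  have l11 := hl' 1 1 1 rfl
  have l12 := hl' 1 2 0 rfl
  have l20 := hl' 2 0 1 rfl
  have l21 := hl' 2 1 0 rfl
  have l22 := hl' 2 2 2 rfl
  have r1 := hh 0 0 2 0 1 1 rfl rfl rfl
  have r2 := hh 0 0 1 0 2 2 rfl rfl rfl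
  have r3 := hh 0 1 2 2 1 0 rfl rfl rfl
  have m1 : μ 0 1 = μ 2 0 := (hmij 0 1).1
  have m2 : μ 0 1 = μ 1 2 := (hmij 0 1).2
  have m3 : μ 1 0 = μ 2 1 := (hmij 1 0).1
  have m4 : μ 1 0 = μ 0 2 := (hmij 1 0).2
  clear hl hl' hmij hrel hh
  rw [l20, l22, l21, l01, l12] at r3
  rw [l20, l00] at r1
  rw [l10, l00] at r2
  rw [l01, l20, l12]
  have key : ∀ i j p : ZMod 3, ∀ v : k, rackOp i j = p → (if i = j then
      cc 0 * cc 0 + c * cc 0 + μ 0 0 else cc 0 * cc 1 + cc 2 * cc 0 + cc 1 * cc 2 +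
      (c + cc 1 + cc 2) * cc 0 + (c + cc 0 + cc 1) * cc 2 + (c + cc 2 + cc 0) * cc 1 + μ 0 1) = v →
      cc i * cc j + cc p * cc i + cc j * cc p +
      l i j * cc i + l p i * cc p + l j p * cc j + μ i j = v → 
      cc i * cc j + cc (rackOp i j) * cc i + cc j * cc (rackOp i j) +
      l i j * cc i + l (rackOp i j) i * cc (rackOp i j) + l j (rackOp i j) * cc j + μ i j =
      if i = j then
      cc 0 * cc 0 + c * cc 0 + μ 0 0 else cc 0 * cc 1 + cc 2 * cc 0 + cc 1 * cc 2 +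
      (c + cc 1 + cc 2) * cc 0 + (c + cc 0 + cc 1) * cc 2 + (c + cc 2 + cc 0) * cc 1 + μ 0 1 := by
    rintro i j p v rfl rfl h
    exact h
  refine zcases _ ⟨zcases _ ⟨?_, ?_, ?_⟩, zcases _ ⟨?_, ?_, ?_⟩, zcases _ ⟨?_, ?_, ?_⟩⟩
  · refine key 0 0 0 _ rfl (if_pos rfl) ?_
    rw [l00]; grind
  · refine key 0 1 2 _ rfl (if_neg (by decide)) ?_
    rw [l01, l20, l12]
  · refine key 0 2 1 _ rfl (if_neg (by decide)) ?_
    rw [l02, l10, l21]; grind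
  · refine key 1 0 2 _ rfl (if_neg (by decide)) ?_
    rw [l10, l21, l02]; grind
  · refine key 1 1 1 _ rfl (if_pos rfl) ?_
    rw [l11]; grind
  · refine key 1 2 0 _ rfl (if_neg (by decide)) ?_
    rw [l12, l01, l20]; grind
  · refine key 2 0 1 _ rfl (if_neg (by decide)) ?_
    rw [l20, l12, l01]; grind
  · refine key 2 1 0 _ rfl (if_neg (by decide)) ?_
    rw [l21, l02, l10]; grind
  · refine key 2 2 2 _ rfl (if_pos rfl) ?_
    rw [l22]; grind

theorem beta_form {k : Type*} [Field k] [CharP k 2] {G : Type*} [Group G]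
    (g : ZMod 3 → G) (hgen : Subgroup.closure (Set.range g) = ⊤)
    (ρ : G →* Equiv.Perm (ZMod 3)) (hρ : ∀ i j : ZMod 3, ρ (g i) j = rackOp i j)
    (b : G → ZMod 3 → k)
    (hb : ∀ (u v : G) (i : ZMod 3), b (u * v) i = b u (ρ v i) + b v i)
    (c : k) (cc : ZMod 3 → k) (hl : ∀ i j, b (g i) j = c + cc j + cc (rackOp i j)) :
    ∃ β : G → k, (∀ u i, b u i = β u + cc i + cc (ρ u i)) ∧ (∀ u, β u * β u + c * β u = 0) ∧
      (∀ u v, β (u * v) = β u + β v) ∧ β 1 = 0 := by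
  have h2 : (2 : k) = 0 := CharTwo.two_eq_zero
  have b1 : ∀ i, b 1 i = 0 := by
    intro i
    have := hb 1 1 i
    simp only [mul_one, map_one, Equiv.Perm.one_apply] at this
    grind
  have key : ∀ u : G, ∃ x : k, (x = 0 ∨ x = c) ∧ ∀ i, b u i = x + cc i + cc (ρ u i) := by
    intro u
    have hu : u ∈ Subgroup.closure (Set.range g) := by rw [hgen]; trivial
    induction hu using Subgroup.closure_induction with
    | mem u hu =>
      obtain ⟨i, rfl⟩ := hu
      exact ⟨c, Or.inr rfl, fun j => by rw [hρ]; exact hl i j⟩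
    | one =>
      refine ⟨0, Or.inl rfl, fun i => ?_⟩
      rw [b1, map_one, Equiv.Perm.one_apply]; grind
    | mul u v hu hv h1 h2' =>
      obtain ⟨x, hx, h1⟩ := h1
      obtain ⟨y, hy, h2'⟩ := h2'
      refine ⟨x + y, by grind, fun i => ?_⟩
      have e1 := h1 (ρ v i)
      have e2 := h2' i
      rw [hb, map_mul, Equiv.Perm.mul_apply]
      grind
    | inv u hu h1 =>
      obtain ⟨x, hx, h1⟩ := h1
      refine ⟨x, hx, fun i => ?_⟩
      have e1 := h1 (ρ u⁻¹ i)
      have e2 := hb u u⁻¹ i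
      rw [mul_inv_cancel, b1] at e2
      rw [← Equiv.Perm.mul_apply, ← map_mul, mul_inv_cancel, map_one, Equiv.Perm.one_apply] at e1
      grind
  choose β h0 hβ using key
  refine ⟨β, hβ, ?_, ?_, ?_⟩
  · intro u
    rcases h0 u with h | h <;> rw [h] <;> grind
  · intro u v
    have e1 := hb u v 0
    have e2 := hβ (u * v) 0
    have e3 := hβ u (ρ v 0)
    have e4 := hβ v 0
    rw [map_mul, Equiv.Perm.mul_apply] at e2
    grind
  · have e1 := hβ 1 0
    rw [b1, map_one, Equiv.Perm.one_apply] at e1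
    grind

end FKL


namespace FKL

theorem li_tri {k M ι : Type*} [Field k] [AddCommGroup M] [Module k M] (e : ι → M)
    (φ : ι → M →ₗ[k] k) (deg : ι → ℕ) (N : ℕ) (hN : ∀ p, deg p ≤ N)
    (h1 : ∀ p, φ p (e p) = 1) (h0 : ∀ p q, p ≠ q → deg q ≤ deg p → φ p (e q) = 0) :
    LinearIndependent k e := by
  rw [linearIndependent_iff']
  intro s r hs
  have key : ∀ n p, p ∈ s → N < deg p + n → r p = 0 := by
    intro n
    induction n with
    | zero => intro p _ h; have := hN p; omega
    | succ n ih =>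
      intro p hp h
      have h2 := congrArg (φ p) hs
      rw [map_sum, map_zero, Finset.sum_eq_single p] at h2
      · rw [map_smul, h1, smul_eq_mul, mul_one] at h2
        exact h2
      · intro q hq hqp
        rw [map_smul]
        rcases le_or_gt (deg q) (deg p) with h' | h'
        · rw [h0 p q (Ne.symm hqp) h', smul_zero]
        · rw [ih q hq (by omega), zero_smul]
      · intro h'; exact absurd hp h'
  intro p hp
  exact key (N + 1) p hp (by omega)

/-- Shifted filtration attached to a subspace. -/
def FF {k E : Type*} [Field k] [Ring E] [Algebra k E] (V : Submodule k E) : ℕ → Submodule k E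
  | 0 => ⊥
  | d + 1 => V ^ d

/-- Elements of the big algebra whose coefficients have values in the filtration. -/
def TT {k E G : Type*} [Field k] [Ring E] [Algebra k E] (V : Submodule k E) (d : ℕ)
    (v : MonoidAlgebra (Module.End k E) G) : Prop := ∀ h e, v.coeff h e ∈ FF V d

section
variable {k E G : Type*} [Field k] [Ring E] [Algebra k E] [Group G] {V : Submodule k E}

theorem FF_mul (h1 : 1 ∈ V) {u : E} (hu : u ∈ V) (d : ℕ) {e : E} (he : e ∈ FF V d) :
    u * e ∈ FF V (d + 1) := by
  cases d with
  | zero =>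
    have : e = 0 := by simpa [FF] using he
    rw [this, mul_zero]; exact zero_mem _
  | succ d =>
    change _ ∈ V ^ (d + 1)
    rw [pow_succ']
    exact Submodule.mul_mem_mul hu he

theorem FF_mono (h1 : 1 ∈ V) (d : ℕ) {e : E} (he : e ∈ FF V d) : e ∈ FF V (d + 1) := by
  have := FF_mul h1 h1 d he
  rwa [one_mul] at this

theorem FF_map (A : E →ₐ[k] E) (hA : ∀ e ∈ V, A e ∈ V) (d : ℕ) {e : E} (he : e ∈ FF V d) :
    A e ∈ FF V d := by
  cases d with
  | zero =>
    have : e = 0 := by simpa [FF] using he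
    rw [this, map_zero]; exact zero_mem _
  | succ d =>
    have h : V.map A.toLinearMap ≤ V := by
      rintro _ ⟨e, he, rfl⟩
      exact hA e he
    have h2 : (V ^ d).map A.toLinearMap ≤ V ^ d := by
      rw [Submodule.map_pow]
      exact pow_left_mono d h
    exact h2 ⟨e, he, rfl⟩

theorem TT_add {d : ℕ} {v w : MonoidAlgebra (Module.End k E) G} (hv : TT V d v) (hw : TT V d w) :
    TT V d (v + w) := by
  intro h e
  rw [MonoidAlgebra.coeff_add]
  exact add_mem (hv h e) (hw h e)

theorem TT_mono (h1 : 1 ∈ V) {d : ℕ} {v : MonoidAlgebra (Module.End k E) G} (hv : TT V d v) :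
    TT V (d + 1) v := fun h e => FF_mono h1 d (hv h e)

theorem TT_left (h1 : 1 ∈ V) {d : ℕ} {v : MonoidAlgebra (Module.End k E) G} (hv : TT V d v)
    {u : E} (hu : u ∈ V) :
    TT V (d + 1) (MonoidAlgebra.single 1 (LinearMap.mulLeft k u) * v) := by
  intro h e
  rw [MonoidAlgebra.coeff_single_one_mul]
  exact FF_mul h1 hu d (hv h e)

theorem TT_act (A : E →ₐ[k] E) (hA : ∀ e ∈ V, A e ∈ V) {d : ℕ}
    {v : MonoidAlgebra (Module.End k E) G} (hv : TT V d v) (g : G) :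
    TT V d (MonoidAlgebra.single g (A.toLinearMap : Module.End k E) * v) := by
  intro h e
  rw [MonoidAlgebra.coeff_single_mul_apply]
  exact FF_map A hA d (hv _ e)

theorem TT_right {d : ℕ} {v : MonoidAlgebra (Module.End k E) G} (hv : TT V d v)
    (r : Module.End k E) : TT V d (v * MonoidAlgebra.single 1 r) := by
  intro h e
  rw [MonoidAlgebra.coeff_mul_single_one]
  exact hv h (r e)

theorem TT_single {d : ℕ} (h : G) (r : Module.End k E) (hr : ∀ e, r e ∈ FF V d) :
    TT V d (MonoidAlgebra.single h r) := by
  classical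
  intro h' e
  rw [MonoidAlgebra.coeff_single_apply]
  split_ifs
  · exact hr e
  · exact zero_mem _
end

theorem indep {k : Type*} [Field k] [CharP k 2] {G : Type*} [Group G]
    (g : ZMod 3 → G) (hg : ∀ i j : ZMod 3, g i * g j = g (rackOp i j) * g i)
    (ρ : G →* Equiv.Perm (ZMod 3)) (hρ : ∀ i j : ZMod 3, ρ (g i) j = rackOp i j)
    (hconj : ∀ (a : G) (i : ZMod 3), a * g i * a⁻¹ = g (ρ a i))
    (b : G → ZMod 3 → k) (μ : ZMod 3 → ZMod 3 → k)
    (hmij : ∀ i j : ZMod 3, μ i j = μ (rackOp i j) i ∧ μ i j = μ j (rackOp i j))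
    {E : Type*} [Ring E] [Algebra k E] (Z y : ZMod 3 → E) (cc : ZMod 3 → k)
    (hy : ∀ i, y i = Z i + cc i • 1)
    (V : Submodule k E) (h1V : 1 ∈ V) (hZV : ∀ i, Z i ∈ V)
    (A : G → E →ₐ[k] E) (hAA : ∀ u v e, A (u * v) e = A u (A v e)) (hA1 : ∀ e, A 1 e = e)
    (hAV : ∀ u, ∀ e ∈ V, A u e ∈ V)
    (hAy : ∀ u i, A u (y i) = y (ρ u i) + b u i • 1)
    (ha : ∀ i j, y i * y j + y (rackOp i j) * y i + y j * y (rackOp i j) + b (g i) j • y i +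
      b (g (rackOp i j)) i • y (rackOp i j) + b (g j) (rackOp i j) • y j + μ i j • 1 = 0)
    (π : E →ₗ[k] (Fin 12 → k))
    (hπ : ∀ a b c, π (ww (Z 0) (Z 1) (Z 2) a b c) = Pi.single (idx a b c) 1)
    (hπV : ∀ d, ∀ e ∈ V ^ d, ∀ j, d < dg j → π e j = 0) 
    (X : G → RingQuot (LRel k g ρ b μ)) (x : ZMod 3 → RingQuot (LRel k g ρ b μ))
    (hX : ∀ h, X h = RingQuot.mkAlgHom k (LRel k g ρ b μ) (FreeAlgebra.ι k (Sum.inl h)))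
    (hx : ∀ i, x i = RingQuot.mkAlgHom k (LRel k g ρ b μ) (FreeAlgebra.ι k (Sum.inr i))) :
    LinearIndependent k (fun p : G × Fin 2 × Fin 3 × Fin 2 =>
      ww (x 0) (x 1) (x 2) p.2.1 p.2.2.1 p.2.2.2 * X p.1) := by
  classical
  have hyV : ∀ i, y i ∈ V := fun i => by
    rw [hy]; exact add_mem (hZV i) (V.smul_mem _ h1V)
  have hinv : ∀ u e, A u⁻¹ (A u e) = e := fun u e => by
    rw [← hAA, inv_mul_cancel, hA1]
  let AL : G → Module.End k E := fun u => (A u).toLinearMap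
  have ALapp : ∀ u e, AL u e = A u e := fun u e => rfl
  let LL : ZMod 3 → Module.End k E := fun i => LinearMap.mulLeft k (y i)
  have ALmul : ∀ u v, AL (u * v) = AL u * AL v := fun u v => LinearMap.ext fun e => hAA u v e
  have AL1 : AL 1 = 1 := LinearMap.ext fun e => hA1 e
  have sm : ∀ (r : k) (h : G) (f : Module.End k E),
      r • MonoidAlgebra.single h f = MonoidAlgebra.single h (r • f) := fun r h f => by
    exact MonoidAlgebra.smul_single _ _ _
  obtain ⟨Φ, hΦX, hΦx⟩ := rep_exists g hg ρ hρ hconj b μ hmij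
    (B := MonoidAlgebra (Module.End k E) G)
    (fun i => MonoidAlgebra.single 1 (LL i))
    (fun h => MonoidAlgebra.single h (AL h))
    (fun h => MonoidAlgebra.single 1 (AL h⁻¹))
    (by intro u v; simp only [MonoidAlgebra.single_mul_single, ALmul])
    (by intro u v; simp only [MonoidAlgebra.single_mul_single, mul_inv_rev, ALmul, mul_one])
    (by simp only [AL1]; rfl)
    (by simp only [inv_one, AL1]; rfl)
    (by
      intro u i
      simp only [MonoidAlgebra.one_def, sm, ← MonoidAlgebra.single_add,
        MonoidAlgebra.single_mul_single, mul_one, one_mul]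
      congr 1
      refine LinearMap.ext fun e => ?_
      change A u (y i * e) = y (ρ u i) * A u e + b u i • A u e
      rw [map_mul, hAy, add_mul, smul_mul_assoc, one_mul])
    (by
      intro u i
      simp only [MonoidAlgebra.one_def, sm, ← MonoidAlgebra.single_add,
        MonoidAlgebra.single_mul_single, mul_one, one_mul]
      congr 1
      refine LinearMap.ext fun e => ?_
      change y i * A u⁻¹ e = A u⁻¹ (y (ρ u i) * e + b u i • e)
      have : y (ρ u i) * e + b u i • e = A u (y i) * e := by
        rw [hAy, add_mul, smul_mul_assoc, one_mul]
      rw [this, map_mul, hinv])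
    (by
      intro i j
      simp only [MonoidAlgebra.one_def, sm, ← MonoidAlgebra.single_add,
        MonoidAlgebra.single_mul_single, mul_one]
      rw [← MonoidAlgebra.single_zero 1]
      congr 1
      refine LinearMap.ext fun e => ?_
      have := congrArg (· * e) (ha i j)
      simp only [add_mul, smul_mul_assoc, one_mul, zero_mul, mul_assoc] at this
      exact this)
  simp only [← hX, ← hx] at hΦX hΦx
  let ε : E →ₗ[k] k := LinearMap.proj 0 ∘ₗ π
  have hε : ε 1 = 1 := by
    have := hπ 0 0 0
    have h' : ww (Z 0) (Z 1) (Z 2) 0 0 0 = 1 := by simp [ww]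
    rw [h'] at this
    change π 1 0 = 1
    rw [this]
    rfl
  let f0 : Module.End k E := LinearMap.smulRight ε (1 : E)
  let f : G → Module.End k E := fun h => AL h * f0 * AL h⁻¹
  have hf : ∀ h e, f h e = ε (A h⁻¹ e) • (1 : E) := fun h e => by
    change A h (ε (A h⁻¹ e) • (1 : E)) = _
    rw [map_smul, map_one]
  let v0 : MonoidAlgebra (Module.End k E) G := MonoidAlgebra.single 1 f0
  let ml : E → Module.End k E := fun w => LinearMap.mulLeft k w
  let P : ℕ → RingQuot (LRel k g ρ b μ) → E → Prop := fun d z w => w ∈ V ^ d ∧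
    ∀ h, ∃ t, TT V d t ∧ Φ (z * X h) v0 = MonoidAlgebra.single h (ml w * f h) + t
  have hsing : ∀ d w h, w ∈ V ^ d → TT V (d + 1) (MonoidAlgebra.single h (ml w * f h)) := by
    intro d w h hw
    apply TT_single
    intro e
    change w * f h e ∈ V ^ d
    rw [hf, mul_smul_comm, mul_one]
    exact Submodule.smul_mem _ _ hw
  have P0 : P 0 1 1 := by
    refine ⟨by rw [pow_zero]; exact Submodule.one_le.mp le_rfl, fun h => ⟨0, ?_, ?_⟩⟩
    · intro h e; exact zero_mem _
    · rw [one_mul, hΦX, add_zero]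
      simp only [v0, MonoidAlgebra.single_mul_single, mul_one]
      congr 1
      refine LinearMap.ext fun e => ?_
      change _ = 1 * f h e
      rw [one_mul]
  have PS : ∀ d z w i, P d z w → P (d + 1) (x i * z) (Z i * w) := by
    rintro d z w i ⟨hw, hz⟩
    refine ⟨by rw [pow_succ']; exact Submodule.mul_mem_mul (hZV i) hw, fun h => ?_⟩
    obtain ⟨t, ht, e⟩ := hz h
    have hu : TT V (d + 1) (Φ (z * X h) v0) := by
      rw [e]; exact TT_add (hsing d w h hw) (TT_mono h1V ht)
    refine ⟨MonoidAlgebra.single h (ml (cc i • w) * f h) + MonoidAlgebra.single 1 (LL i) * t +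
      MonoidAlgebra.single (g i) (AL (g i)) * Φ (z * X h) v0 *
        (MonoidAlgebra.single 1 (LL i) * MonoidAlgebra.single 1 (AL (g i)⁻¹)), ?_, ?_⟩
    · refine TT_add (TT_add (hsing _ _ _ (Submodule.smul_mem _ _ hw))
        (TT_left h1V ht (hyV i))) ?_
      rw [MonoidAlgebra.single_mul_single, one_mul]
      exact TT_right (TT_act (A (g i)) (hAV _) hu (g i)) _
    · rw [mul_assoc, map_mul, Module.End.mul_apply, hΦx]
      rw [← add_assoc, ← add_assoc]
      congr 1
      rw [e, mul_add, ← MonoidAlgebra.single_add, MonoidAlgebra.single_mul_single, one_mul]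
      congr 2
      refine LinearMap.ext fun e => ?_
      change y i * (w * f h e) = Z i * w * f h e + (cc i • w) * f h e
      rw [hy, add_mul, smul_mul_assoc, smul_mul_assoc, one_mul, mul_assoc]
  have PW : ∀ a b c, P (wd a b c) (ww (x 0) (x 1) (x 2) a b c) (ww (Z 0) (Z 1) (Z 2) a b c) := by
    have Q0 : ∀ c : Fin 2, P c.val (![1, x 2] c) (![1, Z 2] c) := by
      intro c
      fin_cases c
      · exact P0
      · have := PS _ _ _ 2 P0
        rw [mul_one, mul_one] at this
        exact this
    have Q1 : ∀ (b : Fin 3) (c : Fin 2), P (b.val + c.val) (![1, x 1, x 1 * x 0] b * ![1, x 2] c)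
        (![1, Z 1, Z 1 * Z 0] b * ![1, Z 2] c) := by
      intro b c
      have q := Q0 c
      generalize ![1, x 2] c = s at *
      generalize ![1, Z 2] c = s' at *
      fin_cases b
      · change P (0 + c.val) (1 * s) (1 * s')
        rwa [one_mul, one_mul, zero_add]
      · have := PS _ _ _ 1 q
        rw [add_comm] at this
        exact this
      · have := PS _ _ _ 1 (PS _ _ _ 0 q)
        rw [← mul_assoc, ← mul_assoc, add_assoc, add_comm] at this
        exact this
    intro a b c
    have q := Q1 b c
    unfold ww wd
    rw [mul_assoc, mul_assoc, add_assoc]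
    fin_cases a
    · change P (0 + _) (1 * _) (1 * _)
      rwa [one_mul, one_mul, zero_add]
    · have := PS _ _ _ 0 q
      rw [add_comm] at this
      exact this
  let ev : G → Fin 12 → MonoidAlgebra (Module.End k E) G →ₗ[k] k := fun h j =>
    { toFun := fun v => π (v.coeff h 1) j
      map_add' := by intro v w; simp
      map_smul' := by intro r v; simp }
  have hev : ∀ h j v, ev h j v = π (v.coeff h 1) j := fun _ _ _ => rfl
  have hff : ∀ h, f h 1 = 1 := fun h => by rw [hf, map_one, hε, one_smul]
  have hco : ∀ p q : G × Fin 2 × Fin 3 × Fin 2, wd q.2.1 q.2.2.1 q.2.2.2 ≤ wd p.2.1 p.2.2.1 p.2.2.2 →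
      ev p.1 (idx p.2.1 p.2.2.1 p.2.2.2)
        (Φ (ww (x 0) (x 1) (x 2) q.2.1 q.2.2.1 q.2.2.2 * X q.1) v0) =
      if p = q then 1 else 0 := by
    rintro ⟨h, a, b', c⟩ ⟨h', a', b'', c'⟩ hle
    simp only at hle ⊢
    obtain ⟨t, ht, e⟩ := (PW a' b'' c').2 h'
    rw [e, map_add, hev, hev]
    have z : π (t.coeff h 1) (idx a b' c) = 0 := by
      have := ht h 1
      cases hd : wd a' b'' c' with
      | zero =>
        rw [hd] at this
        have h0 : t.coeff h 1 = 0 := by simpa [FF] using this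
        rw [h0, map_zero]; rfl
      | succ d =>
        rw [hd] at this
        refine hπV d _ this _ ?_
        rw [dg_idx]; omega
    rw [z, add_zero, MonoidAlgebra.coeff_single_apply]
    by_cases hh : h' = h
    · rw [if_pos hh]
      change π (ww (Z 0) (Z 1) (Z 2) a' b'' c' * f h' 1) _ = _
      rw [hff, mul_one, hπ, Pi.single_apply]
      by_cases hi : idx a b' c = idx a' b'' c'
      · rw [if_pos hi]
        obtain ⟨rfl, rfl, rfl⟩ := idx_inj _ _ _ _ _ _ hi
        rw [if_pos (by rw [hh])]
      · rw [if_neg hi, if_neg]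
        intro hp
        simp only [Prod.mk.injEq] at hp
        obtain ⟨-, rfl, rfl, rfl⟩ := hp
        exact hi rfl
    · rw [if_neg hh, if_neg]
      · simp
      · intro hp
        simp only [Prod.mk.injEq] at hp
        exact hh hp.1.symm
  refine li_tri _ (fun p => ev p.1 (idx p.2.1 p.2.2.1 p.2.2.2) ∘ₗ LinearMap.applyₗ v0 ∘ₗ
    Φ.toLinearMap) (fun p => wd p.2.1 p.2.2.1 p.2.2.2) 4 ?_ ?_ ?_
  · rintro ⟨h, a, b', c⟩
    simp only [wd]; omega
  · intro p
    exact (hco p p le_rfl).trans (if_pos rfl)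
  · intro p q hpq hle
    exact (hco p q hle).trans (if_neg hpq)

end FKL


namespace FKL

theorem L_indep {k : Type*} [Field k] [CharP k 2] {G : Type*} [Group G]
    (g : ZMod 3 → G) (hgen : Subgroup.closure (Set.range g) = ⊤)
    (hg : ∀ i j : ZMod 3, g i * g j = g (rackOp i j) * g i)
    (ρ : G →* Equiv.Perm (ZMod 3)) (hρ : ∀ i j : ZMod 3, ρ (g i) j = rackOp i j)
    (hconj : ∀ (a : G) (i : ZMod 3), a * g i * a⁻¹ = g (ρ a i))
    (b : G → ZMod 3 → k)
    (hb : ∀ (u v : G) (i : ZMod 3), b (u * v) i = b u (ρ v i) + b v i)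
    (μ : ZMod 3 → ZMod 3 → k)
    (hmij : ∀ i j : ZMod 3, μ i j = μ (rackOp i j) i ∧ μ i j = μ j (rackOp i j))
    (hrel : ∀ i j l : ZMod 3,
      μ i j + μ (rackOp l i) (rackOp l j) =
        b (g l) i * (b (g l) (rackOp i j) + b (g i) j) +
        b (g l) j * (b (g l) i + b (g j) (rackOp i j)) +
        b (g l) (rackOp i j) * (b (g l) j + b (g (rackOp i j)) i))
    (X : G → RingQuot (LRel k g ρ b μ)) (x : ZMod 3 → RingQuot (LRel k g ρ b μ))
    (hX : ∀ h, X h = RingQuot.mkAlgHom k (LRel k g ρ b μ) (FreeAlgebra.ι k (Sum.inl h)))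
    (hx : ∀ i, x i = RingQuot.mkAlgHom k (LRel k g ρ b μ) (FreeAlgebra.ι k (Sum.inr i))) :
    LinearIndependent k (fun p : G × Fin 2 × Fin 3 × Fin 2 =>
      ww (x 0) (x 1) (x 2) p.2.1 p.2.2.1 p.2.2.2 * X p.1) := by
  have h2 : (2 : k) = 0 := CharTwo.two_eq_zero
  obtain ⟨c, cc, hl⟩ := lam_form (fun i j => b (g i) j) (by
    intro i j t
    have e1 := hb (g i) (g j) t
    have e2 := hb (g (rackOp i j)) (g i) t
    rw [hρ] at e1 e2
    rw [hg, e2] at e1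
    exact e1.symm)
  obtain ⟨m, n, hmn⟩ := mu_form (fun i j => b (g i) j) μ c cc hl hmij hrel
  obtain ⟨β, hβ, hβ2, hβm, hβ1⟩ := beta_form g hgen ρ hρ b hb c cc hl
  have hal := fun u : G => al_exists (c := c) (m := m) (n := n) (ρ u) (β u) (hβ2 u)
  choose A hA using hal
  obtain ⟨π, hπ, hπV⟩ := pi_exists (k := k) (c := c) (m := m) (n := n)
  have h1V : (1 : EA k c m n) ∈ VE k c m n := Submodule.subset_span (Set.mem_insert _ _)
  have hYV : ∀ i, Y k c m n i ∈ VE k c m n := fun i =>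
    Submodule.subset_span (Set.mem_insert_of_mem _ ⟨i, rfl⟩)
  refine indep g hg ρ hρ hconj b μ hmij (Y k c m n) (fun i => Y k c m n i + cc i • 1) cc
    (fun i => rfl) (VE k c m n) h1V hYV A ?_ ?_ ?_ ?_ ?_ π hπ hπV X x hX hx
  · intro u v e
    have : A (u * v) = (A u).comp (A v) := E_ext _ _ fun i => by
      rw [AlgHom.comp_apply, hA, hA, map_add, hA, map_smul, map_one, map_mul, hβm,
        Equiv.Perm.mul_apply, add_smul, add_assoc]
    rw [this, AlgHom.comp_apply]
  · intro e
    have : A 1 = AlgHom.id k _ := E_ext _ _ fun i => by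
      rw [hA, map_one, hβ1, zero_smul, add_zero]
      rfl
    rw [this, AlgHom.id_apply]
  · intro u e he
    unfold VE at he
    induction he using Submodule.span_induction with
    | mem e he =>
      rcases he with rfl | ⟨i, rfl⟩
      · rw [map_one]; exact h1V
      · rw [hA]; exact add_mem (hYV _) (Submodule.smul_mem _ _ h1V)
    | zero => rw [map_zero]; exact zero_mem _
    | add v w _ _ h1 h2 => rw [map_add]; exact add_mem h1 h2
    | smul r v _ h => rw [map_smul]; exact Submodule.smul_mem _ _ h
  · intro u i
    simp only [map_add, hA, map_smul, map_one, add_assoc, ← add_smul]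
    congr 2
    have := hβ u i
    grind
  · intro i j
    have r := Y_rel (k := k) (c := c) (m := m) (n := n) i j
    rw [← hmn] at r
    have l1 := hl i j
    have l2 := hl (rackOp i j) i
    have l3 := hl j (rackOp i j)
    rw [rack_c1] at l2
    rw [rack_c2] at l3
    have e1 : (cc j + cc (rackOp i j) + b (g i) j) = c := by grind
    have e2 : (cc j + cc i + b (g (rackOp i j)) i) = c := by grind
    have e3 : (cc i + cc (rackOp i j) + b (g j) (rackOp i j)) = c := by grind
    rw [smul_add, smul_add] at r
    rw [show c • Y k c m n i = (cc j + cc (rackOp i j) + b (g i) j) • Y k c m n i by rw [e1],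
      show c • Y k c m n (rackOp i j) =
        (cc j + cc i + b (g (rackOp i j)) i) • Y k c m n (rackOp i j) by rw [e2],
      show c • Y k c m n j =
        (cc i + cc (rackOp i j) + b (g j) (rackOp i j)) • Y k c m n j by rw [e3]] at r
    rw [← r]
    simp only [add_mul, mul_add, smul_add, smul_mul_assoc, mul_smul_comm, one_mul, mul_one,
      add_smul, smul_smul, mul_comm (cc j) (cc i), mul_comm (cc i) (cc (rackOp i j)),
      mul_comm (cc j) (cc (rackOp i j))]
    abel

theorem L_span {k : Type*} [Field k] [CharP k 2] {G : Type*} [Group G]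
    (g : ZMod 3 → G) (ρ : G →* Equiv.Perm (ZMod 3))
    (b : G → ZMod 3 → k) (μ : ZMod 3 → ZMod 3 → k)
    (X : G → RingQuot (LRel k g ρ b μ)) (x : ZMod 3 → RingQuot (LRel k g ρ b μ))
    (hX : ∀ h, X h = RingQuot.mkAlgHom k (LRel k g ρ b μ) (FreeAlgebra.ι k (Sum.inl h)))
    (hx : ∀ i, x i = RingQuot.mkAlgHom k (LRel k g ρ b μ) (FreeAlgebra.ι k (Sum.inr i))) :
    Submodule.span k (Set.range (fun p : G × Fin 2 × Fin 3 × Fin 2 =>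
      ww (x 0) (x 1) (x 2) p.2.1 p.2.2.1 p.2.2.2 * X p.1)) = ⊤ := by
  have rXX : ∀ a c, X a * X c = X (a * c) := by
    intro a c
    have := RingQuot.mkAlgHom_rel k (s := LRel k g ρ b μ) (Or.inl ⟨a, c, rfl, rfl⟩)
    simpa only [map_mul, ← hX] using this
  have rX1 : X 1 = 1 := by
    have := RingQuot.mkAlgHom_rel k (s := LRel k g ρ b μ) (Or.inr (Or.inl ⟨rfl, rfl⟩))
    simpa only [map_one, ← hX] using this
  have rXx : ∀ a i, X a * x i = (x (ρ a i) + b a i • (1 + X (g (ρ a i)))) * X a := by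
    intro a i
    have := RingQuot.mkAlgHom_rel k (s := LRel k g ρ b μ)
      (Or.inr (Or.inr (Or.inl ⟨a, i, rfl, rfl⟩)))
    simpa only [map_mul, map_add, map_smul, map_one, ← hX, ← hx] using this
  have rq : ∀ i j, x i * x j + x (rackOp i j) * x i + x j * x (rackOp i j) + b (g i) j • x i +
      b (g (rackOp i j)) i • x (rackOp i j) + b (g j) (rackOp i j) • x j +
      μ i j • (1 + X (g i * g j)) = 0 := by
    intro i j
    have := RingQuot.mkAlgHom_rel k (s := LRel k g ρ b μ)
      (Or.inr (Or.inr (Or.inr ⟨i, j, rfl, rfl⟩)))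
    simpa only [map_mul, map_add, map_smul, map_one, map_zero, ← hX, ← hx] using this
  let V := Submodule.span k (Set.range X ∪ Set.range (fun p : ZMod 3 × G => x p.1 * X p.2))
  have hXV : ∀ a, X a ∈ V := fun a => Submodule.subset_span (Or.inl ⟨a, rfl⟩)
  have h1V : 1 ∈ V := by rw [← rX1]; exact hXV 1
  have hxV : ∀ i, x i ∈ V := fun i =>
    Submodule.subset_span (Or.inr ⟨(i, 1), by simp only [rX1, mul_one]⟩)
  have hqV : ∀ i j, x i * x j + x (rackOp i j) * x i + x j * x (rackOp i j) ∈ V := by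
    intro i j
    have h := rq i j
    have : x i * x j + x (rackOp i j) * x i + x j * x (rackOp i j) = -(b (g i) j • x i +
      b (g (rackOp i j)) i • x (rackOp i j) + b (g j) (rackOp i j) • x j +
      μ i j • (1 + X (g i * g j))) := by
      rw [eq_neg_iff_add_eq_zero, ← h]
      abel
    rw [this]
    exact neg_mem (add_mem (add_mem (add_mem (V.smul_mem _ (hxV _)) (V.smul_mem _ (hxV _)))
      (V.smul_mem _ (hxV _))) (V.smul_mem _ (add_mem h1V (hXV _))))
  refine span_top X x g (fun a i => ρ a i) b rXX rX1 rXx V rfl ?_ (hqV 0 1) (hqV 1 0) ?_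
  · intro i
    have h := hqV i i
    have hi : rackOp i i = i := by clear h; revert i; decide
    rw [hi, two_smul_zero (k := k), zero_add] at h
    exact h
  · have h1 : (RingQuot.mkAlgHom k (LRel k g ρ b μ)).range = ⊤ :=
      (AlgHom.range_eq_top _).2 (RingQuot.mkAlgHom_surjective k _)
    rw [← h1, ← Algebra.map_top, ← FreeAlgebra.adjoin_range_ι, AlgHom.map_adjoin]
    congr 1
    ext z
    constructor
    · rintro (⟨h, rfl⟩ | ⟨i, rfl⟩)
      · exact ⟨_, ⟨Sum.inl h, rfl⟩, (hX h).symm⟩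
      · exact ⟨_, ⟨Sum.inr i, rfl⟩, (hx i).symm⟩
    · rintro ⟨_, ⟨h | i, rfl⟩, rfl⟩
      · exact Or.inl ⟨h, hX h⟩
      · exact Or.inr ⟨i, hx i⟩

end FKL

/-- Under the presentation hypotheses, if `μ` satisfies eq:mij and eq:rel,
then the family of elements `w · X_g` of `L_{λμ}`, with `g ∈ G` and `w = m₁m₂m₃` ranging over
the 12 monomials with `m₁ ∈ {1, x₀}`, `m₂ ∈ {1, x₁, x₁x₀}`, `m₃ ∈ {1, x₂}`, is a `k`-basis of
`L_{λμ}`; in particular `L_{λμ} ≅ FK₃ ⊗ kG` as `k`-vector spaces, which is the linear content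
of the statement that `L_{λμ}` is a lifting of the Fomin–Kirillov algebra `FK₃` over `kG`. -/
theorem LRel_quotient_basis {k : Type*} [Field k] [CharP k 2] {G : Type*} [Group G]
    (hG : ∃ a c : G, a * c ≠ c * a)
    (g : ZMod 3 → G) (hgen : Subgroup.closure (Set.range g) = ⊤)
    (hg : ∀ i j : ZMod 3, g i * g j = g (rackOp i j) * g i)
    (ρ : G →* Equiv.Perm (ZMod 3)) (hρ : ∀ i j : ZMod 3, ρ (g i) j = rackOp i j)
    (hconj : ∀ (a : G) (i : ZMod 3), a * g i * a⁻¹ = g (ρ a i))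
    (b : G → ZMod 3 → k)
    (hb : ∀ (u v : G) (i : ZMod 3), b (u * v) i = b u (ρ v i) + b v i)
    (lam : ZMod 3 → ZMod 3 → k) (hlam : ∀ i j : ZMod 3, lam i j = b (g i) j)
    (μ : ZMod 3 → ZMod 3 → k)
    (hmij : ∀ i j : ZMod 3, μ i j = μ (rackOp i j) i ∧ μ i j = μ j (rackOp i j))
    (hrel : ∀ i j l : ZMod 3,
      μ i j + μ (rackOp l i) (rackOp l j) =
        lam l i * (lam l (rackOp i j) + lam i j) +
        lam l j * (lam l i + lam j (rackOp i j)) +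
        lam l (rackOp i j) * (lam l j + lam (rackOp i j) i)) :
    (LinearIndependent k (fun p : G × Fin 2 × Fin 3 × Fin 2 =>
      (![1, RingQuot.mkAlgHom k (LRel k g ρ b μ) (FreeAlgebra.ι k (Sum.inr (0 : ZMod 3)))]
          p.2.1) *
      (![1, RingQuot.mkAlgHom k (LRel k g ρ b μ) (FreeAlgebra.ι k (Sum.inr (1 : ZMod 3))),
          RingQuot.mkAlgHom k (LRel k g ρ b μ) (FreeAlgebra.ι k (Sum.inr (1 : ZMod 3))) *
            RingQuot.mkAlgHom k (LRel k g ρ b μ) (FreeAlgebra.ι k (Sum.inr (0 : ZMod 3)))]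
          p.2.2.1) *
      (![1, RingQuot.mkAlgHom k (LRel k g ρ b μ) (FreeAlgebra.ι k (Sum.inr (2 : ZMod 3)))]
          p.2.2.2) *
      RingQuot.mkAlgHom k (LRel k g ρ b μ) (FreeAlgebra.ι k (Sum.inl p.1)))) ∧
    Submodule.span k (Set.range (fun p : G × Fin 2 × Fin 3 × Fin 2 =>
      (![1, RingQuot.mkAlgHom k (LRel k g ρ b μ) (FreeAlgebra.ι k (Sum.inr (0 : ZMod 3)))]
          p.2.1) *
      (![1, RingQuot.mkAlgHom k (LRel k g ρ b μ) (FreeAlgebra.ι k (Sum.inr (1 : ZMod 3))),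
          RingQuot.mkAlgHom k (LRel k g ρ b μ) (FreeAlgebra.ι k (Sum.inr (1 : ZMod 3))) *
            RingQuot.mkAlgHom k (LRel k g ρ b μ) (FreeAlgebra.ι k (Sum.inr (0 : ZMod 3)))]
          p.2.2.1) *
      (![1, RingQuot.mkAlgHom k (LRel k g ρ b μ) (FreeAlgebra.ι k (Sum.inr (2 : ZMod 3)))]
          p.2.2.2) *
      RingQuot.mkAlgHom k (LRel k g ρ b μ) (FreeAlgebra.ι k (Sum.inl p.1)))) = ⊤ := by
  have hl : lam = fun i j => b (g i) j := by
    funext i j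
    exact hlam i j
  subst hl
  exact ⟨FKL.L_indep g hgen hg ρ hρ hconj b hb μ hmij hrel
      (fun h => RingQuot.mkAlgHom k (LRel k g ρ b μ) (FreeAlgebra.ι k (Sum.inl h)))
      (fun i => RingQuot.mkAlgHom k (LRel k g ρ b μ) (FreeAlgebra.ι k (Sum.inr i)))
      (fun _ => rfl) (fun _ => rfl),
    FKL.L_span g ρ b μ
      (fun h => RingQuot.mkAlgHom k (LRel k g ρ b μ) (FreeAlgebra.ι k (Sum.inl h)))
      (fun i => RingQuot.mkAlgHom k (LRel k g ρ b μ) (FreeAlgebra.ι k (Sum.inr i)))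
      (fun _ => rfl) (fun _ => rfl)⟩
end

section
/- Let S be the set of pairs (λ, μ) of functions ZMod 3 × ZMod 3 → F₂ satisfying conditions eq:lij, eq:mij and eq:rel. Define the relation ∼ on S by: (λ, μ) ∼ (λ', μ') if there exist a permutation φ of ZMod 3 with φ(i▷j) = φ(i)▷φ(j) for all i, j (a rack automorphism) and a function p : ZMod 3 → F₂ such that for all i, j ∈ ZMod 3: λ'(φ(i),φ(j)) = λ(i,j) + p(i▷j) + p(j); μ'(φ(i),φ(j)) = μ(i,j) + p(i)p(j) + p(i▷j)p(i) + p(j)p(i▷j); and p(i)λ'(φ(i),φ(j)) + p(i▷j)λ'(φ(i▷j),φ(i)) + p(j)λ'(φ(j),φ(i▷j)) = 0. Then the equivalence relation generated by ∼ partitions S into exactly 10 equivalence classes. -/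
/-- Condition eq:lij. -/
def lijCond (lam : ZMod 3 → ZMod 3 → ZMod 2) : Prop :=
  ∀ i j l : ZMod 3,
    lam i (rackOp j l) + lam j l = lam (rackOp i j) (rackOp i l) + lam i l

/-- Condition eq:mij. -/
def mijCond (μ : ZMod 3 → ZMod 3 → ZMod 2) : Prop :=
  ∀ i j : ZMod 3, μ i j = μ (rackOp i j) i ∧ μ i j = μ j (rackOp i j)

/-- Condition eq:rel. -/
def relCond (lam μ : ZMod 3 → ZMod 3 → ZMod 2) : Prop :=
  ∀ i j l : ZMod 3,
    μ i j + μ (rackOp l i) (rackOp l j) =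
      lam l i * (lam l (rackOp i j) + lam i j) +
      lam l j * (lam l i + lam j (rackOp i j)) +
      lam l (rackOp i j) * (lam l j + lam (rackOp i j) i)

/-- The set `S` of pairs `(λ, μ)` satisfying eq:lij, eq:mij and eq:rel. -/
def LiftingData : Type :=
  {p : (ZMod 3 → ZMod 3 → ZMod 2) × (ZMod 3 → ZMod 3 → ZMod 2) //
    lijCond p.1 ∧ mijCond p.2 ∧ relCond p.1 p.2}

/-- The relation `∼` on `S`: `(λ, μ) ∼ (λ', μ')` iff there exist a rack automorphism `φ` of
`(ZMod 3, ▷)` and `p : ZMod 3 → F₂` satisfying the three compatibility identities. -/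
def simRel (P Q : LiftingData) : Prop :=
  ∃ φ : Equiv.Perm (ZMod 3), (∀ i j : ZMod 3, φ (rackOp i j) = rackOp (φ i) (φ j)) ∧
    ∃ p : ZMod 3 → ZMod 2,
      (∀ i j : ZMod 3, Q.1.1 (φ i) (φ j) = P.1.1 i j + p (rackOp i j) + p j) ∧
      (∀ i j : ZMod 3, Q.1.2 (φ i) (φ j) =
        P.1.2 i j + p i * p j + p (rackOp i j) * p i + p j * p (rackOp i j)) ∧
      (∀ i j : ZMod 3,
        p i * Q.1.1 (φ i) (φ j) + p (rackOp i j) * Q.1.1 (φ (rackOp i j)) (φ i) +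
          p j * Q.1.1 (φ j) (φ (rackOp i j)) = 0)

/-- Normal form of `λ`. -/
def LAM (x y z : ZMod 2) : ZMod 3 → ZMod 3 → ZMod 2 := fun i j =>
  if i = j then x + y + z else if i = 0 then x else if i = 1 then y else z

/-- Normal form of `μ`. -/
def MU (x y z t d : ZMod 2) : ZMod 3 → ZMod 3 → ZMod 2 := fun i j =>
  if i = j then t + (if i = 0 then y * z else if i = 1 then x * z else x * y) else d

/-- The complete invariant. -/
def invF (lam μ : ZMod 3 → ZMod 3 → ZMod 2) : Fin 10 :=
  if lam 0 0 = 0 then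
    (if μ 0 0 + lam 1 0 * lam 2 0 + μ 0 1 = 0 then 0 else 1)
  else
    (if lam 0 1 = 1 ∧ lam 1 0 = 1 then 6 else 2) +
      (if μ 0 0 + lam 1 0 * lam 2 0 = 0 then 0 else 2) + (if μ 0 1 = 0 then 0 else 1)

theorem forall3 {P : ZMod 3 → Prop} (h0 : P 0) (h1 : P 1) (h2 : P 2) : ∀ i, P i := by
  intro i
  fin_cases i
  · exact h0
  · exact h1
  · exact h2

/-- A function given by its nine values. -/
def MAT (a b c d e f g h k : ZMod 2) : ZMod 3 → ZMod 3 → ZMod 2 :=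
  ![![a,b,c],![d,e,f],![g,h,k]]

set_option synthInstance.maxHeartbeats 400000 in
set_option synthInstance.maxSize 4096 in
theorem key : ∀ a b c d e f g h k : ZMod 2, lijCond (MAT a b c d e f g h k) →
  ∀ i j : ZMod 3, MAT a b c d e f g h k i j = LAM b d g i j := by
  unfold lijCond
  decide +kernel

set_option synthInstance.maxHeartbeats 400000 in
set_option synthInstance.maxSize 4096 in
theorem key2 : ∀ x y z a b c d e f g h k : ZMod 2, mijCond (MAT a b c d e f g h k) →
   relCond (LAM x y z) (MAT a b c d e f g h k) →
  ∀ i j : ZMod 3, MAT a b c d e f g h k i j = MU x y z (a + y * z) b i j := by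
  unfold mijCond relCond
  decide +kernel

theorem eta3 (l : ZMod 3 → ZMod 3 → ZMod 2) :
    l = MAT (l 0 0) (l 0 1) (l 0 2) (l 1 0) (l 1 1) (l 1 2) (l 2 0) (l 2 1) (l 2 2) := by
  funext i j
  revert i j
  refine forall3 (forall3 ?_ ?_ ?_) (forall3 ?_ ?_ ?_) (forall3 ?_ ?_ ?_) <;> rfl

theorem normal (P : LiftingData) : ∃ x y z t d, P.1 = (LAM x y z, MU x y z t d) := by
  obtain ⟨⟨l, m⟩, h1, h2, h3⟩ := P
  simp only at h1 h2 h3 ⊢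
  have hl : l = LAM (l 0 1) (l 1 0) (l 2 0) := by
    rw [eta3 l] at h1
    conv_lhs => rw [eta3 l]
    funext i j
    exact key _ _ _ _ _ _ _ _ _ h1 i j
  rw [hl] at h3
  rw [eta3 m] at h2 h3
  refine ⟨l 0 1, l 1 0, l 2 0, m 0 0 + l 1 0 * l 2 0, m 0 1, Prod.ext hl ?_⟩
  show m = _
  conv_lhs => rw [eta3 m]
  funext i j
  exact key2 _ _ _ _ _ _ _ _ _ _ _ _ h2 h3 i j

theorem valid : ∀ x y z t d : ZMod 2, lijCond (LAM x y z) ∧ mijCond (MU x y z t d) ∧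
    relCond (LAM x y z) (MU x y z t d) := by
  unfold lijCond mijCond relCond
  decide +kernel

/-- The element of `S` with given parameters. -/
def mkD (x y z t d : ZMod 2) : LiftingData := ⟨(LAM x y z, MU x y z t d), valid x y z t d⟩

theorem normal' (P : LiftingData) : ∃ x y z t d, P = mkD x y z t d := by
  obtain ⟨x, y, z, t, d, h⟩ := normal P
  exact ⟨x, y, z, t, d, Subtype.ext h⟩

theorem inv_perm : ∀ (x y z t d : ZMod 2) (φ : Equiv.Perm (ZMod 3)),
    invF (fun i j => LAM x y z (φ i) (φ j)) (fun i j => MU x y z t d (φ i) (φ j)) =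
      invF (LAM x y z) (MU x y z t d) := by
  decide +kernel

theorem inv_p : ∀ (x y z t d u v w : ZMod 2),
    (∀ i j : ZMod 3,
      (![u, v, w] : ZMod 3 → ZMod 2) i * (LAM x y z i j + (![u, v, w] : ZMod 3 → ZMod 2) (rackOp i j) + (![u, v, w] : ZMod 3 → ZMod 2) j) +
      (![u, v, w] : ZMod 3 → ZMod 2) (rackOp i j) * (LAM x y z (rackOp i j) i + (![u, v, w] : ZMod 3 → ZMod 2) (rackOp (rackOp i j) i) + (![u, v, w] : ZMod 3 → ZMod 2) i) +
      (![u, v, w] : ZMod 3 → ZMod 2) j * (LAM x y z j (rackOp i j) + (![u, v, w] : ZMod 3 → ZMod 2) (rackOp j (rackOp i j)) + (![u, v, w] : ZMod 3 → ZMod 2) (rackOp i j)) = 0) →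
    invF (fun i j => LAM x y z i j + (![u, v, w] : ZMod 3 → ZMod 2) (rackOp i j) + (![u, v, w] : ZMod 3 → ZMod 2) j)
      (fun i j => MU x y z t d i j + (![u, v, w] : ZMod 3 → ZMod 2) i * (![u, v, w] : ZMod 3 → ZMod 2) j +
        (![u, v, w] : ZMod 3 → ZMod 2) (rackOp i j) * (![u, v, w] : ZMod 3 → ZMod 2) i +
        (![u, v, w] : ZMod 3 → ZMod 2) j * (![u, v, w] : ZMod 3 → ZMod 2) (rackOp i j)) =
      invF (LAM x y z) (MU x y z t d) := by
  decide +kernel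

theorem inv_sim (P Q : LiftingData) (h : simRel P Q) : invF P.1.1 P.1.2 = invF Q.1.1 Q.1.2 := by
  obtain ⟨φ, -, p, h1, h2, h3⟩ := h
  obtain ⟨x, y, z, t, d, rfl⟩ := normal' P
  obtain ⟨x', y', z', t', d', rfl⟩ := normal' Q
  simp only [mkD] at *
  have hp : p = ![p 0, p 1, p 2] := by
    funext i
    revert i
    exact forall3 rfl rfl rfl
  simp only [h1] at h3
  rw [← inv_perm x' y' z' t' d' φ]
  simp only [h1, h2]
  rw [hp] at h3 ⊢
  exact (inv_p x y z t d _ _ _ h3).symm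

/-- Representatives of the ten classes. -/
def rep : Fin 10 → LiftingData :=
  ![mkD 0 0 0 0 0, mkD 0 0 0 1 0, mkD 1 0 0 0 0, mkD 1 0 0 0 1, mkD 1 0 0 1 0, mkD 1 0 0 1 1,
    mkD 1 1 1 0 0, mkD 1 1 1 0 1, mkD 1 1 1 1 0, mkD 1 1 1 1 1]

theorem inv_rep : ∀ k, invF (rep k).1.1 (rep k).1.2 = k := by
  decide +kernel

theorem sim_rep : ∀ (x y z t d : ZMod 2),
    simRel (mkD x y z t d) (rep (invF (LAM x y z) (MU x y z t d))) := by
  have : ∀ (x y z t d : ZMod 2), ∃ φ : Equiv.Perm (ZMod 3),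
    (∀ i j : ZMod 3, φ (rackOp i j) = rackOp (φ i) (φ j)) ∧ ∃ u v w : ZMod 2,
      let p : ZMod 3 → ZMod 2 := ![u, v, w]
      let P := mkD x y z t d
      let Q := rep (invF (LAM x y z) (MU x y z t d))
      (∀ i j : ZMod 3, Q.1.1 (φ i) (φ j) = P.1.1 i j + p (rackOp i j) + p j) ∧
      (∀ i j : ZMod 3, Q.1.2 (φ i) (φ j) =
        P.1.2 i j + p i * p j + p (rackOp i j) * p i + p j * p (rackOp i j)) ∧
      (∀ i j : ZMod 3,
        p i * Q.1.1 (φ i) (φ j) + p (rackOp i j) * Q.1.1 (φ (rackOp i j)) (φ i) +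
          p j * Q.1.1 (φ j) (φ (rackOp i j)) = 0) := by
    decide +kernel
  intro x y z t d
  obtain ⟨φ, hφ, u, v, w, h⟩ := this x y z t d
  exact ⟨φ, hφ, _, h⟩

theorem sim_rep' (P : LiftingData) : simRel P (rep (invF P.1.1 P.1.2)) := by
  obtain ⟨x, y, z, t, d, rfl⟩ := normal' P
  exact sim_rep x y z t d


/-- The equivalence relation generated by `∼` partitions `S` into exactly
10 equivalence classes. -/

theorem card_lifting_classes : Nat.card (Quot simRel) = 10 := by
  have e : Function.Bijective
      (Quot.lift (fun P : LiftingData => invF P.1.1 P.1.2) inv_sim : Quot simRel → Fin 10) := by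
    constructor
    · rintro ⟨P⟩ ⟨Q⟩ h
      have h' : invF P.1.1 P.1.2 = invF Q.1.1 Q.1.2 := h
      have hP := Quot.sound (sim_rep' P)
      have hQ := Quot.sound (sim_rep' Q)
      rw [h'] at hP
      exact hP.trans hQ.symm
    · intro k
      exact ⟨Quot.mk _ (rep k), inv_rep k⟩
  rw [Nat.card_eq_of_bijective _ e, Nat.card_eq_fintype_card, Fintype.card_fin]
end
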